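/- arXiv:1803.04146 — 3 statements merged into one kernel-verified Lean document; each statement's English description precedes it below -/
import Mathlib

section
/- There exists a finite set S of prime numbers such that for every finite field 𝔽_q whose characteristic does not lie in S, the number of pairs (F, ℓ), where F is a smooth homogeneous cubic form over 𝔽_q and ℓ is a 2-dimensional 𝔽_q-linear subspace of 𝔽_q⁴ on which F vanishes identically, equals q⁴ · (q⁴ − 1)(q⁴ − q)(q⁴ − q²)(q⁴ − q³). -/
open MvPolynomial

/-- A homogeneous cubic form over a field `K` is smooth if its four partial derivatives
have no common zero other than `0` over the algebraic closure of `K`. -/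
def SmoothCubic (K : Type) [Field K] (F : MvPolynomial (Fin 4) K) : Prop :=
  ∀ v : Fin 4 → AlgebraicClosure K, v ≠ 0 →
    ∃ i : Fin 4,
      eval v (pderiv i (map (algebraMap K (AlgebraicClosure K)) F)) ≠ 0

open scoped Polynomial

section SquarefreeCount

variable {K : Type*} [Field K]

theorem exists_monic_sq_mul_squarefree {f : K[X]} (hf : f ≠ 0) :
    ∃ d g : K[X], d.Monic ∧ Squarefree g ∧ d ^ 2 * g = f := by
  induction hn : f.natDegree using Nat.strong_induction_on generalizing f with
  | _ n ih =>
    by_cases hs : Squarefree f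
    · exact ⟨1, f, Polynomial.monic_one, hs, by simp⟩
    · simp only [Squarefree, not_forall] at hs
      obtain ⟨x, ⟨c, rfl⟩, hx⟩ := hs
      have hx0 : x ≠ 0 := by rintro rfl; simp at hf
      have hc0 : c ≠ 0 := by rintro rfl; simp at hf
      have hxd : 0 < x.natDegree := by
        rw [Nat.pos_iff_ne_zero]
        intro h
        exact hx (Polynomial.isUnit_iff_degree_eq_zero.2
          (by rw [Polynomial.degree_eq_natDegree hx0, h]; rfl))
      obtain ⟨d, g, hd, hg, rfl⟩ := ih c.natDegree (by
        rw [← hn, Polynomial.natDegree_mul (mul_ne_zero hx0 hx0) hc0,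
          Polynomial.natDegree_mul hx0 hx0]; omega) hc0 rfl
      have hl : x.leadingCoeff ≠ 0 := Polynomial.leadingCoeff_ne_zero.2 hx0
      refine ⟨x * Polynomial.C x.leadingCoeff⁻¹ * d, Polynomial.C (x.leadingCoeff ^ 2) * g,
        (Polynomial.monic_mul_leadingCoeff_inv hx0).mul hd, ?_, ?_⟩
      · have hu : IsUnit (Polynomial.C (x.leadingCoeff ^ 2)) :=
          Polynomial.isUnit_C.2 (pow_ne_zero 2 hl).isUnit
        exact hg.squarefree_of_dvd (hu.mul_left_dvd.2 dvd_rfl)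
      · have : Polynomial.C x.leadingCoeff⁻¹ * Polynomial.C x.leadingCoeff = 1 := by
          rw [← Polynomial.C_mul, inv_mul_cancel₀ hl, Polynomial.C_1]
        rw [Polynomial.C_pow]
        linear_combination (x ^ 2 * d ^ 2 * g) *
          (Polynomial.C x.leadingCoeff⁻¹ * Polynomial.C x.leadingCoeff + 1) * this

theorem dvd_of_sq_dvd_sq_mul_squarefree {R : Type*} [CommRing R] [IsDomain R]
    [UniqueFactorizationMonoid R] {a b g : R} (hb : b ≠ 0) (hg : Squarefree g)
    (h : a ^ 2 ∣ b ^ 2 * g) : a ∣ b := by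
  obtain ⟨b', a', e, hab, rfl, rfl⟩ := UniqueFactorizationMonoid.exists_reduced_factors b hb a
  have he : e ≠ 0 := left_ne_zero_of_mul hb
  rw [mul_pow, mul_pow, mul_assoc, mul_dvd_mul_iff_left (pow_ne_zero 2 he)] at h
  have h' : a' ^ 2 ∣ g := (hab.symm.pow).dvd_of_dvd_mul_left h
  exact mul_dvd_mul_left e (hg a' (by rwa [← sq])).dvd

theorem monic_sq_mul_squarefree_unique {d₁ d₂ g₁ g₂ : K[X]} (h₁ : d₁.Monic) (h₂ : d₂.Monic)
    (hg₁ : Squarefree g₁) (hg₂ : Squarefree g₂) (h : d₁ ^ 2 * g₁ = d₂ ^ 2 * g₂) :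
    d₁ = d₂ ∧ g₁ = g₂ := by
  have hd : d₁ = d₂ := by
    refine Polynomial.eq_of_monic_of_associated h₁ h₂ (associated_of_dvd_dvd ?_ ?_)
    · exact dvd_of_sq_dvd_sq_mul_squarefree h₂.ne_zero hg₂ ⟨g₁, h.symm⟩
    · exact dvd_of_sq_dvd_sq_mul_squarefree h₁.ne_zero hg₁ ⟨g₂, h⟩
  subst hd
  exact ⟨rfl, mul_left_cancel₀ (pow_ne_zero 2 h₁.ne_zero) h⟩

variable [Fintype K]

theorem finite_setOf_natDegree_le (K : Type*) [Field K] [Fintype K] (n : ℕ) :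
    {f : K[X] | f.natDegree ≤ n}.Finite := by
  have : Finite (Polynomial.degreeLT K (n + 1)) :=
    Finite.of_equiv _ (Polynomial.degreeLTEquiv K (n + 1)).symm.toEquiv
  refine (Set.toFinite (Polynomial.degreeLT K (n + 1) : Set K[X])).subset fun f hf => ?_
  rw [SetLike.mem_coe, Polynomial.mem_degreeLT]
  exact Polynomial.degree_le_natDegree.trans_lt (by exact_mod_cast Nat.lt_succ_of_le hf)

/-- Dehomogenizations of the binary forms of degree `n` which vanish at most simply at infinity. -/
noncomputable def topPolys (K : Type*) [Field K] [Fintype K] (n : ℕ) : Finset K[X] :=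
  ((finite_setOf_natDegree_le K n).subset
    (t := {f : K[X] | f ≠ 0 ∧ (f.natDegree = n ∨ f.natDegree + 1 = n)})
    (fun _ hf => by rcases hf.2 with h | h <;> simp only [Set.mem_ofPred_eq] <;> omega)).toFinset

open Classical in
/-- Dehomogenizations of the squarefree binary forms of degree `n`. -/
noncomputable def squarefreePolys (K : Type*) [Field K] [Fintype K] (n : ℕ) : Finset K[X] :=
  (topPolys K n).filter Squarefree

/-- The monic polynomials of degree `n`. -/
noncomputable def monicPolys (K : Type*) [Field K] [Fintype K] (n : ℕ) : Finset K[X] :=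
  ((finite_setOf_natDegree_le K n).subset
    (t := {f : K[X] | f.Monic ∧ f.natDegree = n}) (fun _ hf => hf.2.le)).toFinset

theorem mem_topPolys {n : ℕ} {f : K[X]} :
    f ∈ topPolys K n ↔ f ≠ 0 ∧ (f.natDegree = n ∨ f.natDegree + 1 = n) := by
  simp [topPolys]

theorem mem_squarefreePolys {n : ℕ} {f : K[X]} :
    f ∈ squarefreePolys K n ↔ Squarefree f ∧ (f.natDegree = n ∨ f.natDegree + 1 = n) := by
  simp only [squarefreePolys, Finset.mem_filter, mem_topPolys]
  exact ⟨fun h => ⟨h.2, h.1.2⟩, fun h => ⟨⟨h.1.ne_zero, h.2⟩, h.1⟩⟩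

theorem mem_monicPolys {n : ℕ} {f : K[X]} :
    f ∈ monicPolys K n ↔ f.Monic ∧ f.natDegree = n := by
  simp [monicPolys]

theorem monicPolys_zero : monicPolys K 0 = {1} := by
  ext f
  rw [mem_monicPolys, Finset.mem_singleton]
  exact ⟨fun h => h.1.natDegree_eq_zero.1 h.2, fun h => by simp [h]⟩

theorem card_monicPolys (n : ℕ) : (monicPolys K n).card = Fintype.card K ^ n := by
  have e : {f // f ∈ monicPolys K n} ≃ Polynomial.degreeLT K n :=
    { toFun := fun f => ⟨f.1 - Polynomial.X ^ n, by
        obtain ⟨h1, h2⟩ := mem_monicPolys.1 f.2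
        rw [Polynomial.mem_degreeLT]
        have hd : f.1.degree = n := by rw [Polynomial.degree_eq_natDegree h1.ne_zero, h2]
        rw [← hd]
        exact Polynomial.degree_sub_lt_left (by rw [hd, Polynomial.degree_X_pow]) h1.ne_zero
          (by rw [h1.leadingCoeff, Polynomial.leadingCoeff_X_pow])⟩
      invFun := fun g => ⟨Polynomial.X ^ n + g.1, by
        have hg := Polynomial.mem_degreeLT.1 g.2
        have hm := Polynomial.monic_X_pow_add hg
        refine mem_monicPolys.2 ⟨hm, ?_⟩
        have h := Polynomial.degree_add_eq_left_of_degree_lt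
          (p := (Polynomial.X ^ n : K[X])) (q := g.1) (by rwa [Polynomial.degree_X_pow])
        rw [Polynomial.degree_X_pow] at h
        exact Polynomial.natDegree_eq_of_degree_eq_some h⟩
      left_inv := fun f => by simp
      right_inv := fun g => by simp }
  have := Nat.card_congr (e.trans (Polynomial.degreeLTEquiv K n).toEquiv)
  simpa [Nat.card_eq_fintype_card] using this

theorem sum_topPolys_eq_sum_squarefreePolys {M : Type*} [AddCommMonoid M] (m : ℕ)
    (φ : K[X] → M) :
    ∑ f ∈ topPolys K (2 * m + 1), φ f = ∑ j ∈ Finset.range (m + 1),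
      ∑ d ∈ monicPolys K j, ∑ g ∈ squarefreePolys K (2 * (m - j) + 1), φ (d ^ 2 * g) := by
  simp_rw [← Finset.sum_product', Finset.sum_sigma']
  symm
  refine Finset.sum_bij (fun x _ => x.2.1 ^ 2 * x.2.2) ?_ ?_ ?_ (fun _ _ => rfl)
  · rintro ⟨j, d, g⟩ hx
    simp only [Finset.mem_sigma, Finset.mem_product, Finset.mem_range, mem_monicPolys,
      mem_squarefreePolys] at hx
    obtain ⟨hj, ⟨hd, rfl⟩, hg, hgd⟩ := hx
    refine mem_topPolys.2 ⟨mul_ne_zero (pow_ne_zero 2 hd.ne_zero) hg.ne_zero, ?_⟩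
    rw [Polynomial.natDegree_mul (pow_ne_zero 2 hd.ne_zero) hg.ne_zero,
      Polynomial.natDegree_pow]
    omega
  · rintro ⟨j, d, g⟩ hx ⟨j', d', g'⟩ hx' h
    simp only [Finset.mem_sigma, Finset.mem_product, Finset.mem_range, mem_monicPolys,
      mem_squarefreePolys] at hx hx'
    obtain ⟨hj, ⟨hd, rfl⟩, hg, hgd⟩ := hx
    obtain ⟨hj', ⟨hd', rfl⟩, hg', hgd'⟩ := hx'
    obtain ⟨rfl, rfl⟩ := monic_sq_mul_squarefree_unique hd hd' hg hg' h
    rfl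
  · intro f hf
    obtain ⟨hf0, hfd⟩ := mem_topPolys.1 hf
    obtain ⟨d, g, hd, hg, rfl⟩ := exists_monic_sq_mul_squarefree hf0
    rw [Polynomial.natDegree_mul (pow_ne_zero 2 hd.ne_zero) hg.ne_zero,
      Polynomial.natDegree_pow] at hfd
    refine ⟨⟨d.natDegree, d, g⟩, ?_, rfl⟩
    simp only [Finset.mem_sigma, Finset.mem_product, Finset.mem_range, mem_monicPolys,
      mem_squarefreePolys]
    refine ⟨by omega, ⟨hd, trivial⟩, hg, by omega⟩

end SquarefreeCount

section QuadraticResidues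

open scoped QuadraticAlgebra

variable {K : Type*} [Field K]

/-- The residue of a polynomial modulo `X ^ 2 - δ`. -/
noncomputable def quadraticResidue (δ : K) : K[X] →ₐ[K] QuadraticAlgebra K δ 0 :=
  Polynomial.aeval QuadraticAlgebra.omega

theorem quadraticResidue_X (δ : K) : quadraticResidue δ Polynomial.X = ⟨0, 1⟩ := by
  simp [quadraticResidue, QuadraticAlgebra.omega]

theorem quadraticResidue_C (δ a : K) : quadraticResidue δ (Polynomial.C a) = ⟨a, 0⟩ := by
  simp [quadraticResidue]
  rfl

theorem quadraticResidue_X_sq_sub_C (δ : K) :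
    quadraticResidue δ (Polynomial.X ^ 2 - Polynomial.C δ) = 0 := by
  rw [map_sub, map_pow, quadraticResidue_X, quadraticResidue_C]
  ext <;> simp [sq]

theorem quadraticResidue_linear (δ a b : K) :
    quadraticResidue δ (Polynomial.C a + Polynomial.C b * Polynomial.X) = ⟨a, b⟩ := by
  rw [map_add, map_mul, quadraticResidue_X, quadraticResidue_C, quadraticResidue_C]
  ext <;> simp

/-- Every polynomial is uniquely a multiple of `X ^ 2 - δ` plus a linear polynomial, whose
coefficients are given by the residue. -/
theorem eq_mul_add_linear (δ : K) (f : K[X]) :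
    f = (Polynomial.X ^ 2 - Polynomial.C δ) * (f /ₘ (Polynomial.X ^ 2 - Polynomial.C δ)) +
      (Polynomial.C (quadraticResidue δ f).re +
        Polynomial.C (quadraticResidue δ f).im * Polynomial.X) := by
  have hm : (Polynomial.X ^ 2 - Polynomial.C δ).Monic :=
    Polynomial.monic_X_pow_sub_C δ two_ne_zero
  have h := Polynomial.modByMonic_add_div f (Polynomial.X ^ 2 - Polynomial.C δ)
  have hd : (f %ₘ (Polynomial.X ^ 2 - Polynomial.C δ)).natDegree ≤ 1 := by
    have := Polynomial.natDegree_modByMonic_lt f hm (fun h => by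
      simpa [Polynomial.natDegree_X_pow_sub_C] using congrArg Polynomial.natDegree h)
    rw [Polynomial.natDegree_X_pow_sub_C] at this
    omega
  obtain ⟨a, b, hab⟩ := Polynomial.exists_eq_X_add_C_of_natDegree_le_one hd
  have hr : quadraticResidue δ f = ⟨b, a⟩ := by
    conv_lhs => rw [← h, map_add, map_mul, quadraticResidue_X_sq_sub_C, zero_mul, add_zero, hab,
      add_comm]
    exact quadraticResidue_linear δ b a
  rw [hr]
  conv_lhs => rw [← h, hab]
  ring

theorem QuadraticAlgebra.exists_isUnit_neg_sq_eq_mul {δ : K} (hδ : δ ≠ 0) (h2 : (2 : K) ≠ 0)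
    (u : QuadraticAlgebra K δ 0) : ∃ w, IsUnit w ∧ -u ^ 2 = w * u := by
  by_cases hn : IsUnit u
  · exact ⟨-u, hn.neg, by ring⟩
  by_cases hu : u = 0
  · exact ⟨1, isUnit_one, by simp [hu]⟩
  rw [QuadraticAlgebra.isUnit_iff_norm_isUnit, isUnit_iff_ne_zero, not_not,
    QuadraticAlgebra.norm_def] at hn
  have ha : u.re ≠ 0 := by
    intro ha
    simp [ha, hδ] at hn
    exact hu (QuadraticAlgebra.ext ha hn)
  refine ⟨algebraMap K _ (-(2 * u.re)), (isUnit_iff_ne_zero.2 ?_).map _, ?_⟩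
  · exact neg_ne_zero.2 (mul_ne_zero h2 ha)
  · ext
    · simp [sq]
      linear_combination hn
    · simp [sq]
      ring

theorem natDegree_mul_add_linear (δ a b : K) {h : K[X]} (hh : h ≠ 0) :
    ((Polynomial.X ^ 2 - Polynomial.C δ) * h +
      (Polynomial.C a + Polynomial.C b * Polynomial.X)).natDegree = h.natDegree + 2 := by
  have hm : (Polynomial.X ^ 2 - Polynomial.C δ).Monic :=
    Polynomial.monic_X_pow_sub_C δ two_ne_zero
  have h1 : ((Polynomial.X ^ 2 - Polynomial.C δ) * h).natDegree = h.natDegree + 2 := by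
    rw [hm.natDegree_mul' hh, Polynomial.natDegree_X_pow_sub_C, add_comm]
  rw [Polynomial.natDegree_add_eq_left_of_natDegree_lt, h1]
  rw [h1]
  have : (Polynomial.C a + Polynomial.C b * Polynomial.X).natDegree ≤ 1 := by
    rw [add_comm]
    exact Polynomial.natDegree_linear_le
  omega

variable [Fintype K]

noncomputable instance QuadraticAlgebra.instFintype (δ : K) : Fintype (QuadraticAlgebra K δ 0) :=
  Fintype.ofEquiv _ (QuadraticAlgebra.equivProd δ 0).symm

theorem QuadraticAlgebra.card (δ : K) :
    Fintype.card (QuadraticAlgebra K δ 0) = Fintype.card K ^ 2 := by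
  rw [Fintype.card_congr (QuadraticAlgebra.equivProd δ 0), Fintype.card_prod, sq]

theorem sum_topPolys_add_two {M : Type*} [AddCommMonoid M] (δ : K) (n : ℕ) (hn : 0 < n)
    (φ : QuadraticAlgebra K δ 0 → M) :
    ∑ f ∈ topPolys K (n + 2), φ (quadraticResidue δ f) = (topPolys K n).card • ∑ v, φ v := by
  rw [← Finset.sum_const, ← Finset.sum_product']
  refine Finset.sum_bij' (fun f _ => (f /ₘ (Polynomial.X ^ 2 - Polynomial.C δ),
      quadraticResidue δ f))
    (fun x _ => (Polynomial.X ^ 2 - Polynomial.C δ) * x.1 +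
      (Polynomial.C x.2.re + Polynomial.C x.2.im * Polynomial.X)) ?_ ?_ ?_ ?_ ?_
  · intro f hf
    have hm : (Polynomial.X ^ 2 - Polynomial.C δ).Monic :=
      Polynomial.monic_X_pow_sub_C δ two_ne_zero
    obtain ⟨h0, hd⟩ := mem_topPolys.1 hf
    simp only [Finset.mem_product, Finset.mem_univ, and_true, mem_topPolys, ne_eq,
      Polynomial.natDegree_divByMonic _ hm, Polynomial.natDegree_X_pow_sub_C,
      Polynomial.divByMonic_eq_zero_iff hm]
    refine ⟨?_, by omega⟩
    rw [Polynomial.degree_eq_natDegree h0, Polynomial.degree_eq_natDegree hm.ne_zero,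
      Polynomial.natDegree_X_pow_sub_C]
    norm_cast
    omega
  · rintro ⟨h, v⟩ hx
    simp only [Finset.mem_product, Finset.mem_univ, and_true, mem_topPolys] at hx
    have := natDegree_mul_add_linear δ v.re v.im hx.1
    refine mem_topPolys.2 ⟨?_, ?_⟩
    · intro h0
      simp only at h0
      rw [h0, Polynomial.natDegree_zero] at this
      omega
    · simp only
      omega
  · intro f hf
    exact (eq_mul_add_linear δ f).symm
  · rintro ⟨h, v⟩ hx
    have hm : (Polynomial.X ^ 2 - Polynomial.C δ).Monic :=
      Polynomial.monic_X_pow_sub_C δ two_ne_zero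
    refine Prod.ext ?_ ?_
    · refine (Polynomial.div_modByMonic_unique h (Polynomial.C v.re + Polynomial.C v.im *
        Polynomial.X) hm ⟨add_comm _ _, ?_⟩).1
      rw [Polynomial.degree_X_pow_sub_C two_pos, add_comm]
      exact Polynomial.degree_linear_lt_degree_C_mul_X_sq (a := (1 : K)) one_ne_zero |>.trans_le
        (by simp)
    · simp only
      rw [map_add, map_mul, quadraticResidue_X_sq_sub_C, zero_mul, zero_add,
        quadraticResidue_linear]
  · intro f _
    rfl

theorem sum_topPolys_one {M : Type*} [AddCommGroup M] (δ : K)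
    (φ : QuadraticAlgebra K δ 0 → M) :
    ∑ f ∈ topPolys K 1, φ (quadraticResidue δ f) = ∑ v, φ v - φ 0 := by
  classical
  rw [eq_sub_iff_add_eq, add_comm, ← Finset.add_sum_erase _ _ (Finset.mem_univ 0)]
  congr 1
  refine Finset.sum_bij' (fun f _ => quadraticResidue δ f)
    (fun v _ => Polynomial.C v.re + Polynomial.C v.im * Polynomial.X) ?_ ?_ ?_ ?_ ?_
  · intro f hf
    obtain ⟨h0, hd⟩ := mem_topPolys.1 hf
    obtain ⟨a, b, rfl⟩ := Polynomial.exists_eq_X_add_C_of_natDegree_le_one (p := f) (by omega)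
    simp only [Finset.mem_erase, Finset.mem_univ, and_true]
    rw [add_comm, quadraticResidue_linear]
    intro h
    rw [QuadraticAlgebra.ext_iff] at h
    simp only [QuadraticAlgebra.re_zero, QuadraticAlgebra.im_zero] at h
    simp [h] at h0
  · intro v hv
    simp only [Finset.mem_erase, Finset.mem_univ, and_true] at hv
    refine mem_topPolys.2 ⟨fun h => hv ?_, ?_⟩
    · rw [← map_zero (quadraticResidue δ), ← h, quadraticResidue_linear]
    · have : (Polynomial.C v.re + Polynomial.C v.im * Polynomial.X).natDegree ≤ 1 := by
        rw [add_comm]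
        exact Polynomial.natDegree_linear_le
      omega
  · intro f hf
    obtain ⟨h0, hd⟩ := mem_topPolys.1 hf
    obtain ⟨a, b, rfl⟩ := Polynomial.exists_eq_X_add_C_of_natDegree_le_one (p := f) (by omega)
    rw [add_comm (Polynomial.C a * Polynomial.X), quadraticResidue_linear]
  · intro v _
    exact quadraticResidue_linear δ _ _
  · intro f _
    rfl

theorem sum_topPolys_unit_mul {M : Type*} [AddCommGroup M] (δ : K) (m : ℕ)
    {w : QuadraticAlgebra K δ 0} (hw : IsUnit w) (φ : QuadraticAlgebra K δ 0 → M) :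
    ∑ f ∈ topPolys K (2 * m + 1), φ (w * quadraticResidue δ f) =
      ∑ f ∈ topPolys K (2 * m + 1), φ (quadraticResidue δ f) := by
  obtain ⟨w, rfl⟩ := hw
  have h : ∑ v, φ (w * v) = ∑ v, φ v := Equiv.sum_comp w.mulLeft φ
  cases m with
  | zero =>
    rw [sum_topPolys_one δ (fun v => φ (w * v)), sum_topPolys_one, h, mul_zero]
  | succ m =>
    rw [show 2 * (m + 1) + 1 = 2 * m + 1 + 2 by ring,
      sum_topPolys_add_two δ _ (by omega) (fun v => φ (w * v)),
      sum_topPolys_add_two δ _ (by omega), h]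

/-- Squarefree polynomials of bounded degree are equidistributed among the associated residues
modulo `X ^ 2 - δ`. -/
theorem sum_squarefreePolys_unit_mul {M : Type*} [AddCommGroup M] (δ : K) (m : ℕ)
    {w : QuadraticAlgebra K δ 0} (hw : IsUnit w) (φ : QuadraticAlgebra K δ 0 → M) :
    ∑ f ∈ squarefreePolys K (2 * m + 1), φ (w * quadraticResidue δ f) =
      ∑ f ∈ squarefreePolys K (2 * m + 1), φ (quadraticResidue δ f) := by
  induction m using Nat.strong_induction_on generalizing φ with
  | _ m ih =>
    have h := sum_topPolys_unit_mul δ m hw φ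
    rw [sum_topPolys_eq_sum_squarefreePolys m (fun f => φ (w * quadraticResidue δ f)),
      sum_topPolys_eq_sum_squarefreePolys m (fun f => φ (quadraticResidue δ f)),
      Finset.sum_range_succ', Finset.sum_range_succ'] at h
    simp only [monicPolys_zero, Finset.sum_singleton, one_pow, one_mul, Nat.sub_zero] at h
    refine add_left_cancel (Eq.trans ?_ h)
    refine congrArg₂ _ (Finset.sum_congr rfl fun j hj => Finset.sum_congr rfl fun d _ => ?_) rfl
    rw [Finset.mem_range] at hj
    have h' := ih (m - (j + 1)) (by omega) (fun v => φ (quadraticResidue δ d ^ 2 * v))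
    simp only [map_mul, map_pow, mul_left_comm w]
    exact h'.symm

theorem card_squarefreePolys_five : ((squarefreePolys K 5).card : ℤ) =
    (Fintype.card K : ℤ) ^ 3 * ((Fintype.card K : ℤ) - 1) * ((Fintype.card K : ℤ) ^ 2 - 1) := by
  have h1 := sum_topPolys_one (1 : K) (fun _ => (1 : ℤ))
  have h3 := sum_topPolys_add_two (1 : K) 1 one_pos (fun _ => (1 : ℤ))
  have h5 := sum_topPolys_add_two (1 : K) 3 (by norm_num) (fun _ => (1 : ℤ))
  have g1 := sum_topPolys_eq_sum_squarefreePolys (K := K) 0 (fun _ => (1 : ℤ))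
  have g3 := sum_topPolys_eq_sum_squarefreePolys (K := K) 1 (fun _ => (1 : ℤ))
  have g5 := sum_topPolys_eq_sum_squarefreePolys (K := K) 2 (fun _ => (1 : ℤ))
  simp [Finset.sum_range_succ, card_monicPolys, QuadraticAlgebra.card] at h1 h3 h5 g1 g3 g5
  rw [← g1] at g3 g5
  linear_combination -g5 + (Fintype.card K : ℤ) * g3 + h5 +
    ((Fintype.card K : ℤ) ^ 2 - Fintype.card K) * h3 +
    ((Fintype.card K : ℤ) ^ 4 - (Fintype.card K : ℤ) ^ 3) * h1

end QuadraticResidues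

section NormalQuintic

variable {K : Type*} [Field K]

/-- The polynomial with the given four coefficients. -/
noncomputable def cubicPoly (a b c d : K) : K[X] :=
  Polynomial.C a + Polynomial.C b * Polynomial.X + Polynomial.C c * Polynomial.X ^ 2 +
    Polynomial.C d * Polynomial.X ^ 3

theorem natDegree_cubicPoly_le (a b c d : K) : (cubicPoly a b c d).natDegree ≤ 3 := by
  unfold cubicPoly
  compute_degree

theorem exists_eq_cubicPoly {f : K[X]} (hf : f.natDegree ≤ 3) :
    ∃ a b c d, f = cubicPoly a b c d := by
  refine ⟨f.coeff 0, f.coeff 1, f.coeff 2, f.coeff 3, ?_⟩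
  conv_lhs => rw [f.as_sum_range' 4 (by omega)]
  simp only [Finset.sum_range_succ, Finset.sum_range_zero, zero_add, cubicPoly,
    ← Polynomial.C_mul_X_pow_eq_monomial, pow_zero, mul_one, pow_one]

theorem cubicPoly_inj {a b c d a' b' c' d' : K} (h : cubicPoly a b c d = cubicPoly a' b' c' d') :
    a = a' ∧ b = b' ∧ c = c' ∧ d = d' := by
  have h0 := congrArg (Polynomial.coeff · 0) h
  have h1 := congrArg (Polynomial.coeff · 1) h
  have h2 := congrArg (Polynomial.coeff · 2) h
  have h3 := congrArg (Polynomial.coeff · 3) h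
  simp [cubicPoly, Polynomial.coeff_X, Polynomial.coeff_C, Polynomial.coeff_X_pow] at h0 h1 h2 h3
  exact ⟨h0, h1, h2, h3⟩

/-- The discriminant of the conic bundle with normal pencil `δ` and remaining coefficients `r`,
restricted to the affine line `x = 1`. -/
noncomputable def normalQuintic (δ : K) (r : Fin 10 → K) : K[X] :=
  (Polynomial.C δ - Polynomial.X ^ 2) * cubicPoly (r 6) (r 7) (r 8) (r 9) +
    2 * Polynomial.X * cubicPoly (r 0) (r 1) (r 2) 0 * cubicPoly (r 3) (r 4) (r 5) 0 -
    Polynomial.C δ * cubicPoly (r 0) (r 1) (r 2) 0 ^ 2 - cubicPoly (r 3) (r 4) (r 5) 0 ^ 2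

theorem natDegree_normalQuintic_le (δ : K) (r : Fin 10 → K) :
    (normalQuintic δ r).natDegree ≤ 5 := by
  unfold normalQuintic cubicPoly
  simp only [map_zero, zero_mul, add_zero]
  compute_degree

theorem quadraticResidue_normalQuintic (δ : K) (r : Fin 10 → K) :
    quadraticResidue δ (normalQuintic δ r) = -(⟨r 3 + δ * r 5 - δ * r 1,
      r 4 - r 0 - δ * r 2⟩ : QuadraticAlgebra K δ 0) ^ 2 := by
  simp only [normalQuintic, cubicPoly, map_add, map_sub, map_mul, map_pow, quadraticResidue_X,
    quadraticResidue_C, two_mul]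
  ext <;> simp [pow_succ] <;> ring

variable [Fintype K]

theorem card_normalQuintic {δ : K} (hδ : δ ≠ 0) (h2 : (2 : K) ≠ 0) :
    Nat.card {r : Fin 10 → K // normalQuintic δ r ∈ squarefreePolys K 5} =
      Fintype.card K ^ 4 * (squarefreePolys K 5).card := by
  classical
  have key : Nat.card {r : Fin 10 → K // normalQuintic δ r ∈ squarefreePolys K 5} =
      Nat.card ((K × K × K × K) × {x : QuadraticAlgebra K δ 0 × squarefreePolys K 5 //
        quadraticResidue δ x.2.1 = -x.1 ^ 2}) := by
    refine Nat.card_congr (Equiv.ofBijective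
      (fun r => ((r.1 0, r.1 1, r.1 2, r.1 5), ⟨(⟨r.1 3 + δ * r.1 5 - δ * r.1 1,
        r.1 4 - r.1 0 - δ * r.1 2⟩, ⟨normalQuintic δ r.1, r.2⟩),
          quadraticResidue_normalQuintic δ r.1⟩)) ⟨?_, ?_⟩)
    · rintro ⟨r, hr⟩ ⟨s, hs⟩ h
      simp only [Prod.mk.injEq, Subtype.mk.injEq, QuadraticAlgebra.ext_iff] at h
      obtain ⟨⟨e0, e1, e2, e5⟩, ⟨e3, e4⟩, h'⟩ := h
      rw [e1, e5] at e3
      rw [e0, e2] at e4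
      replace e3 : r 3 = s 3 := by linear_combination e3
      replace e4 : r 4 = s 4 := by linear_combination e4
      have hm : (Polynomial.C δ - Polynomial.X ^ 2) ≠ (0 : K[X]) := by
        rw [← neg_sub, neg_ne_zero]
        exact (Polynomial.monic_X_pow_sub_C δ two_ne_zero).ne_zero
      simp only [normalQuintic, e0, e1, e2, e3, e4, e5, add_left_inj, sub_left_inj] at h'
      obtain ⟨e6, e7, e8, e9⟩ := cubicPoly_inj (mul_left_cancel₀ hm h')
      refine Subtype.ext (funext fun i => ?_)
      fin_cases i <;> assumption
    · rintro ⟨⟨a, b, c, d⟩, ⟨⟨u, ⟨f, hf⟩⟩, hu⟩⟩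
      simp only at hu
      set s : Fin 10 → K :=
        ![a, b, c, u.re + δ * b - δ * d, u.im + a + δ * c, d, 0, 0, 0, 0] with hs
      have h0 := eq_mul_add_linear δ (f - normalQuintic δ s)
      have hres : quadraticResidue δ (f - normalQuintic δ s) = 0 := by
        rw [map_sub, hu, quadraticResidue_normalQuintic, sub_eq_zero]
        congr 2
        ext
        · change _ = u.re + δ * b - δ * d + δ * d - δ * b
          ring
        · change _ = u.im + a + δ * c - a - δ * c
          ring
      simp only [hres, QuadraticAlgebra.re_zero, QuadraticAlgebra.im_zero, map_zero, zero_mul,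
        add_zero] at h0
      have hm : (Polynomial.X ^ 2 - Polynomial.C δ).Monic :=
        Polynomial.monic_X_pow_sub_C δ two_ne_zero
      have hdeg : (-((f - normalQuintic δ s) /ₘ (Polynomial.X ^ 2 - Polynomial.C δ))).natDegree
          ≤ 3 := by
        rw [Polynomial.natDegree_neg, Polynomial.natDegree_divByMonic _ hm,
          Polynomial.natDegree_X_pow_sub_C]
        have h1 := Polynomial.natDegree_sub_le f (normalQuintic δ s)
        have h2 := natDegree_normalQuintic_le δ s
        have h3 := (mem_squarefreePolys.1 hf).2
        omega
      obtain ⟨k, l, m, n, hk⟩ := exists_eq_cubicPoly hdeg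
      have hf' : normalQuintic δ ![a, b, c, u.re + δ * b - δ * d, u.im + a + δ * c, d, k, l, m, n]
          = f := by
        have h1 : normalQuintic δ
            ![a, b, c, u.re + δ * b - δ * d, u.im + a + δ * c, d, k, l, m, n] =
            (Polynomial.C δ - Polynomial.X ^ 2) * cubicPoly k l m n + normalQuintic δ s := by
          simp [normalQuintic, hs, cubicPoly]
          ring
        rw [h1, ← hk]
        linear_combination -h0
      refine ⟨⟨_, by rw [hf']; exact hf⟩, Prod.ext rfl (Subtype.ext (Prod.ext ?_ ?_))⟩
      · ext
        · change u.re + δ * b - δ * d + δ * d - δ * b = u.re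
          ring
        · change u.im + a + δ * c - a - δ * c = u.im
          ring
      · exact Subtype.ext hf'
  have count (u : QuadraticAlgebra K δ 0) :
      ∑ f ∈ squarefreePolys K 5, (if quadraticResidue δ f = -u ^ 2 then 1 else 0) =
      ∑ f ∈ squarefreePolys K 5, if quadraticResidue δ f = u then 1 else 0 := by
    obtain ⟨w, hw, huw⟩ := QuadraticAlgebra.exists_isUnit_neg_sq_eq_mul hδ h2 u
    have h := sum_squarefreePolys_unit_mul δ 2 hw (fun v => if v = -u ^ 2 then (1 : ℤ) else 0)
    simp only [huw, hw.mul_right_inj, Nat.reduceMul, Nat.reduceAdd] at h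
    rw [huw]
    exact_mod_cast h.symm
  rw [key, Nat.card_prod, Nat.card_eq_fintype_card (α := Subtype _), Fintype.card_subtype,
    Finset.card_filter, Fintype.sum_prod_type]
  have attach (u : QuadraticAlgebra K δ 0) :
      ∑ f : squarefreePolys K 5, (if quadraticResidue δ f.1 = -u ^ 2 then 1 else 0) =
      ∑ f ∈ squarefreePolys K 5, if quadraticResidue δ f = u then 1 else 0 := by
    rw [← count, Finset.univ_eq_attach]
    exact Finset.sum_attach (squarefreePolys K 5)
      (fun f => if quadraticResidue δ f = -u ^ 2 then 1 else 0)
  simp only [attach]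
  rw [Finset.sum_comm]
  simp only [Finset.sum_ite_eq, Finset.mem_univ, if_true, Finset.sum_const, smul_eq_mul, mul_one,
    Fintype.card_prod, Nat.card_eq_fintype_card]
  ring

end NormalQuintic

section NormalCubic

/-- The partial derivatives of the cubic form with normal pencil `δ` and remaining
coefficients `s`, as functions of the coordinates. -/
def normalGradient {L : Type*} [Field L] (δ : L) (s : Fin 10 → L) (x y z w : L) : Fin 4 → L :=
  ![z ^ 2 + δ * w ^ 2 + 2 * (2 * s 0 * x + s 1 * y) * z + 2 * (2 * s 3 * x + s 4 * y) * w +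
      3 * s 6 * x ^ 2 + 2 * s 7 * x * y + s 8 * y ^ 2,
    2 * z * w + 2 * (s 1 * x + 2 * s 2 * y) * z + 2 * (s 4 * x + 2 * s 5 * y) * w +
      s 7 * x ^ 2 + 2 * s 8 * x * y + 3 * s 9 * y ^ 2,
    2 * (x * z + y * w + (s 0 * x ^ 2 + s 1 * x * y + s 2 * y ^ 2)),
    2 * (y * z + δ * x * w + (s 3 * x ^ 2 + s 4 * x * y + s 5 * y ^ 2))]

theorem eval_normalQuintic {L : Type*} [Field L] (δ : L) (s : Fin 10 → L) (y : L) :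
    (normalQuintic δ s).eval y =
      (δ - y ^ 2) * (s 6 + s 7 * y + s 8 * y ^ 2 + s 9 * y ^ 3) +
        2 * y * (s 0 + s 1 * y + s 2 * y ^ 2) * (s 3 + s 4 * y + s 5 * y ^ 2) -
        δ * (s 0 + s 1 * y + s 2 * y ^ 2) ^ 2 - (s 3 + s 4 * y + s 5 * y ^ 2) ^ 2 := by
  simp [normalQuintic, cubicPoly]

theorem eval_derivative_normalQuintic {L : Type*} [Field L] (δ : L) (s : Fin 10 → L) (y : L) :
    (normalQuintic δ s).derivative.eval y =
      -2 * y * (s 6 + s 7 * y + s 8 * y ^ 2 + s 9 * y ^ 3) +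
        (δ - y ^ 2) * (s 7 + 2 * s 8 * y + 3 * s 9 * y ^ 2) +
        2 * (s 0 + s 1 * y + s 2 * y ^ 2) * (s 3 + s 4 * y + s 5 * y ^ 2) +
        2 * y * ((s 1 + 2 * s 2 * y) * (s 3 + s 4 * y + s 5 * y ^ 2) +
          (s 0 + s 1 * y + s 2 * y ^ 2) * (s 4 + 2 * s 5 * y)) -
        2 * δ * (s 0 + s 1 * y + s 2 * y ^ 2) * (s 1 + 2 * s 2 * y) -
        2 * (s 3 + s 4 * y + s 5 * y ^ 2) * (s 4 + 2 * s 5 * y) := by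
  simp [normalQuintic, cubicPoly, Polynomial.derivative_pow, Polynomial.derivative_ofNat]
  ring

theorem normalQuintic_eq {L : Type*} [Field L] (δ : L) (s : Fin 10 → L) :
    normalQuintic δ s =
      cubicPoly (δ * s 6 - δ * s 0 ^ 2 - s 3 ^ 2)
        (δ * s 7 + 2 * s 0 * s 3 - 2 * δ * s 0 * s 1 - 2 * s 3 * s 4)
        (δ * s 8 - s 6 + 2 * (s 0 * s 4 + s 1 * s 3) - δ * (s 1 ^ 2 + 2 * s 0 * s 2) -
          (s 4 ^ 2 + 2 * s 3 * s 5))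
        (δ * s 9 - s 7 + 2 * (s 0 * s 5 + s 1 * s 4 + s 2 * s 3) - 2 * δ * s 1 * s 2 -
          2 * s 4 * s 5) +
      Polynomial.C (-s 8 + 2 * (s 1 * s 5 + s 2 * s 4) - δ * s 2 ^ 2 - s 5 ^ 2) *
        Polynomial.X ^ 4 +
      Polynomial.C (-s 9 + 2 * s 2 * s 5) * Polynomial.X ^ 5 := by
  simp only [normalQuintic, cubicPoly, map_add, map_sub, map_mul, map_neg, map_pow, map_zero,
    map_ofNat]
  ring

theorem coeff_four_normalQuintic {L : Type*} [Field L] (δ : L) (s : Fin 10 → L) :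
    (normalQuintic δ s).coeff 4 =
      -s 8 + 2 * (s 1 * s 5 + s 2 * s 4) - δ * s 2 ^ 2 - s 5 ^ 2 := by
  rw [normalQuintic_eq, Polynomial.coeff_add, Polynomial.coeff_add,
    Polynomial.coeff_eq_zero_of_natDegree_lt ((natDegree_cubicPoly_le _ _ _ _).trans_lt
      (by norm_num)), Polynomial.coeff_C_mul_X_pow, Polynomial.coeff_C_mul_X_pow]
  simp

theorem coeff_five_normalQuintic {L : Type*} [Field L] (δ : L) (s : Fin 10 → L) :
    (normalQuintic δ s).coeff 5 = -s 9 + 2 * s 2 * s 5 := by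
  rw [normalQuintic_eq, Polynomial.coeff_add, Polynomial.coeff_add,
    Polynomial.coeff_eq_zero_of_natDegree_lt ((natDegree_cubicPoly_le _ _ _ _).trans_lt
      (by norm_num)), Polynomial.coeff_C_mul_X_pow, Polynomial.coeff_C_mul_X_pow]
  simp

theorem exists_normalGradient_eq_zero_of_root {L : Type*} [Field L] [IsAlgClosed L]
    (h2 : (2 : L) ≠ 0)
    {δ : L} (hδ : δ ≠ 0) (s : Fin 10 → L) {y : L}
    (h0 : (normalQuintic δ s).eval y = 0) (h1 : (normalQuintic δ s).derivative.eval y = 0) :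
    ∃ z w, normalGradient δ s 1 y z w = 0 := by
  rw [eval_normalQuintic] at h0
  rw [eval_derivative_normalQuintic] at h1
  set q₁ := s 0 + s 1 * y + s 2 * y ^ 2 with hq₁
  set q₂ := s 3 + s 4 * y + s 5 * y ^ 2 with hq₂
  suffices h : ∃ z w, z + y * w + q₁ = 0 ∧ y * z + δ * w + q₂ = 0 ∧
      q₁ * z + q₂ * w + (s 6 + s 7 * y + s 8 * y ^ 2 + s 9 * y ^ 3) = 0 ∧
      2 * z * w + 2 * (s 1 + 2 * s 2 * y) * z + 2 * (s 4 + 2 * s 5 * y) * w +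
        s 7 + 2 * s 8 * y + 3 * s 9 * y ^ 2 = 0 by
    obtain ⟨z, w, e1, e2, e3, e4⟩ := h
    refine ⟨z, w, ?_⟩
    funext i
    fin_cases i
    · simp only [normalGradient]
      simp
      linear_combination (norm := (simp only [hq₁, hq₂]; ring)) z * e1 + w * e2 + 3 * e3 - y * e4
    · simp [normalGradient]
      linear_combination e4
    · simp [normalGradient, h2]
      linear_combination e1
    · simp [normalGradient, h2]
      linear_combination e2
  by_cases hD : δ - y ^ 2 = 0
  · have hy : y ≠ 0 := by
      rintro rfl
      exact hδ (by linear_combination hD)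
    have e2 : q₂ = y * q₁ := by
      have : (q₂ - y * q₁) ^ 2 = 0 := by
        linear_combination -h0 + (s 6 + s 7 * y + s 8 * y ^ 2 + s 9 * y ^ 3 - q₁ ^ 2) * hD
      linear_combination pow_eq_zero_iff two_ne_zero |>.1 this
    have e3 : s 6 + s 7 * y + s 8 * y ^ 2 + s 9 * y ^ 3 = q₁ ^ 2 := by
      have : (2 * y) * (s 6 + s 7 * y + s 8 * y ^ 2 + s 9 * y ^ 3 - q₁ ^ 2) = 0 := by
        rw [e2] at h1
        linear_combination -h1 + (s 7 + 2 * s 8 * y + 3 * s 9 * y ^ 2 -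
          2 * q₁ * (s 1 + 2 * s 2 * y)) * hD
      linear_combination (mul_eq_zero.1 this).resolve_left (mul_ne_zero h2 hy)
    obtain ⟨t, ht⟩ : ∃ t, -2 * y * (t * t) + (2 * q₁ + 2 * (s 1 + 2 * s 2 * y) * y -
        2 * (s 4 + 2 * s 5 * y)) * t + (s 7 + 2 * s 8 * y + 3 * s 9 * y ^ 2 -
        2 * (s 1 + 2 * s 2 * y) * q₁) = 0 := by
      have : NeZero (2 : L) := ⟨h2⟩
      obtain ⟨r, hr⟩ := IsAlgClosed.exists_pow_nat_eq
        (discrim (-2 * y) (2 * q₁ + 2 * (s 1 + 2 * s 2 * y) * y -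
        2 * (s 4 + 2 * s 5 * y)) (s 7 + 2 * s 8 * y + 3 * s 9 * y ^ 2 -
        2 * (s 1 + 2 * s 2 * y) * q₁)) two_pos
      exact exists_quadratic_eq_zero (mul_ne_zero (neg_ne_zero.2 h2) hy) ⟨r, by rw [← sq, hr]⟩
    refine ⟨-q₁ + t * y, -t, by ring, ?_, ?_, ?_⟩
    · linear_combination e2 - t * hD
    · linear_combination e3 - t * e2
    · linear_combination ht
  · refine ⟨-(δ * q₁ - y * q₂) / (δ - y ^ 2), -(q₂ - y * q₁) / (δ - y ^ 2), ?_, ?_, ?_, ?_⟩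
    · field_simp
      ring
    · field_simp
      ring
    · field_simp
      linear_combination h0
    · field_simp
      linear_combination (δ - y ^ 2) * h1 + 2 * y * h0

theorem exists_normalGradient_eq_zero_of_coeff {L : Type*} [Field L] {δ : L} {s : Fin 10 → L}
    (h4 : (normalQuintic δ s).coeff 4 = 0) (h5 : (normalQuintic δ s).coeff 5 = 0) :
    normalGradient δ s 0 1 (-s 5) (-s 2) = 0 := by
  rw [coeff_four_normalQuintic] at h4
  rw [coeff_five_normalQuintic] at h5
  funext i
  fin_cases i
  · simp [normalGradient]
    linear_combination -h4
  · simp [normalGradient]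
    linear_combination -3 * h5
  · simp [normalGradient]
  · simp [normalGradient]

theorem normalGradient_smul {L : Type*} [Field L] (δ : L) (s : Fin 10 → L) (c x y z w : L) :
    normalGradient δ s (c * x) (c * y) (c * z) (c * w) =
      c ^ 2 • normalGradient δ s x y z w := by
  funext i
  fin_cases i <;> simp [normalGradient] <;> ring

theorem root_of_normalGradient_eq_zero {L : Type*} [Field L] (h2 : (2 : L) ≠ 0)
    (h3 : (3 : L) ≠ 0) {δ : L} {s : Fin 10 → L} {y z w : L}
    (h : normalGradient δ s 1 y z w = 0) :
    (normalQuintic δ s).eval y = 0 ∧ (normalQuintic δ s).derivative.eval y = 0 := by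
  rw [eval_normalQuintic, eval_derivative_normalQuintic]
  have hx := congrFun h 0
  have hy := congrFun h 1
  have e1 := congrFun h 2
  have e2 := congrFun h 3
  simp [normalGradient, h2] at hx hy e1 e2
  have e3 : (s 0 + s 1 * y + s 2 * y ^ 2) * z + (s 3 + s 4 * y + s 5 * y ^ 2) * w +
      (s 6 + s 7 * y + s 8 * y ^ 2 + s 9 * y ^ 3) = 0 := by
    refine (mul_eq_zero.1 (?_ : 3 * _ = (0 : L))).resolve_left h3
    linear_combination hx - z * e1 - w * e2 + y * hy
  constructor
  · linear_combination
      (y * (s 3 + s 4 * y + s 5 * y ^ 2) - δ * (s 0 + s 1 * y + s 2 * y ^ 2)) * e1 +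
      (y * (s 0 + s 1 * y + s 2 * y ^ 2) - (s 3 + s 4 * y + s 5 * y ^ 2)) * e2 +
      (δ - y ^ 2) * e3
  · linear_combination
      ((s 3 + s 4 * y + s 5 * y ^ 2) + y * (s 4 + 2 * s 5 * y) - δ * (s 1 + 2 * s 2 * y)) * e1 +
      ((s 0 + s 1 * y + s 2 * y ^ 2) + y * (s 1 + 2 * s 2 * y) - (s 4 + 2 * s 5 * y)) * e2 -
      2 * y * e3 + (-δ * e1 + y * e2) * (w + (s 1 + 2 * s 2 * y)) +
      (y * e1 - e2) * (z + (s 4 + 2 * s 5 * y)) + (δ - y ^ 2) * hy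

theorem coeff_eq_zero_of_normalGradient_eq_zero {L : Type*} [Field L] (h2 : (2 : L) ≠ 0)
    (h3 : (3 : L) ≠ 0) {δ : L} {s : Fin 10 → L} {z w : L}
    (h : normalGradient δ s 0 1 z w = 0) :
    (normalQuintic δ s).coeff 4 = 0 ∧ (normalQuintic δ s).coeff 5 = 0 := by
  rw [coeff_four_normalQuintic, coeff_five_normalQuintic]
  have hx := congrFun h 0
  have hy := congrFun h 1
  have e1 := congrFun h 2
  have e2 := congrFun h 3
  simp [normalGradient, h2] at hx hy e1 e2
  constructor
  · linear_combination -hx + (2 * s 1 + z - s 5) * e2 + (2 * s 4 + δ * (w - s 2)) * e1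
  · refine (mul_eq_zero.1 (?_ : 3 * _ = (0 : L))).resolve_left h3
    linear_combination -hy + (2 * w + 4 * s 2) * e2 + (4 * s 5 - 2 * s 5) * e1

theorem eq_zero_of_normalGradient_eq_zero {L : Type*} [Field L] (h2 : (2 : L) ≠ 0)
    {δ : L} (hδ : δ ≠ 0) {s : Fin 10 → L} {z w : L}
    (h : normalGradient δ s 0 0 z w = 0) : z = 0 ∧ w = 0 := by
  have hx := congrFun h 0
  have hy := congrFun h 1
  simp [normalGradient, h2] at hx hy
  obtain rfl | rfl := hy <;> simp_all

/-- The normal cubic is singular exactly if its quintic has a multiple root, where the point at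
infinity counts as a root of multiplicity five minus the degree. -/
theorem exists_normalGradient_eq_zero_iff {L : Type*} [Field L] [IsAlgClosed L]
    (h2 : (2 : L) ≠ 0) (h3 : (3 : L) ≠ 0) {δ : L} (hδ : δ ≠ 0) (s : Fin 10 → L) :
    (∃ v : Fin 4 → L, v ≠ 0 ∧ normalGradient δ s (v 0) (v 1) (v 2) (v 3) = 0) ↔
      ((normalQuintic δ s).coeff 4 = 0 ∧ (normalQuintic δ s).coeff 5 = 0) ∨
        ∃ y, (normalQuintic δ s).eval y = 0 ∧ (normalQuintic δ s).derivative.eval y = 0 := by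
  constructor
  · rintro ⟨v, hv, h⟩
    have scale : ∀ c : L, normalGradient δ s (c * v 0) (c * v 1) (c * v 2) (c * v 3) = 0 :=
      fun c ↦ by rw [normalGradient_smul, h, smul_zero]
    by_cases hx : v 0 = 0
    · by_cases hy : v 1 = 0
      · rw [hx, hy] at h
        obtain ⟨hz, hw⟩ := eq_zero_of_normalGradient_eq_zero h2 hδ h
        exact absurd (_root_.funext fun i ↦ by fin_cases i <;> assumption) hv
      · have := scale (v 1)⁻¹
        rw [hx, inv_mul_cancel₀ hy, mul_zero] at this
        exact Or.inl (coeff_eq_zero_of_normalGradient_eq_zero h2 h3 this)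
    · have := scale (v 0)⁻¹
      rw [inv_mul_cancel₀ hx] at this
      exact Or.inr ⟨_, root_of_normalGradient_eq_zero h2 h3 this⟩
  · rintro (⟨h4, h5⟩ | ⟨y, h0, h1⟩)
    · exact ⟨![0, 1, -s 5, -s 2], fun h ↦ by simpa using congrFun h 1,
        exists_normalGradient_eq_zero_of_coeff h4 h5⟩
    · obtain ⟨z, w, h⟩ := exists_normalGradient_eq_zero_of_root h2 hδ s h0 h1
      exact ⟨![1, y, z, w], fun h ↦ by simpa using congrFun h 0, h⟩

theorem map_normalQuintic {K L : Type*} [Field K] [Field L] (f : K →+* L) (δ : K)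
    (r : Fin 10 → K) :
    (normalQuintic δ r).map f = normalQuintic (f δ) (fun i ↦ f (r i)) := by
  simp [normalQuintic, cubicPoly]

theorem forall_normalGradient_ne_zero_iff {K L : Type*} [Field K] [Fintype K] [Field L]
    [IsAlgClosed L] [Algebra K L] (h2 : (2 : K) ≠ 0) (h3 : (3 : K) ≠ 0) {δ : K} (hδ : δ ≠ 0)
    (r : Fin 10 → K) :
    (∀ v : Fin 4 → L, v ≠ 0 → normalGradient (algebraMap K L δ) (fun i ↦ algebraMap K L (r i))
        (v 0) (v 1) (v 2) (v 3) ≠ 0) ↔ normalQuintic δ r ∈ squarefreePolys K 5 := by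
  have inj := (algebraMap K L).injective
  have h2' : (2 : L) ≠ 0 := map_ofNat (algebraMap K L) 2 ▸ (map_ne_zero (algebraMap K L)).2 h2
  have h3' : (3 : L) ≠ 0 := map_ofNat (algebraMap K L) 3 ▸ (map_ne_zero (algebraMap K L)).2 h3
  have h := exists_normalGradient_eq_zero_iff h2' h3' ((map_ne_zero (algebraMap K L)).2 hδ)
    (fun i ↦ algebraMap K L (r i))
  have h' := not_congr h
  simp only [not_exists, not_and, not_or] at h'
  rw [h', ← map_normalQuintic, mem_squarefreePolys, ← PerfectField.separable_iff_squarefree,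
    Polynomial.separable_def, Polynomial.isCoprime_iff_aeval_ne_zero_of_isAlgClosed K L,
    Polynomial.coeff_map, Polynomial.coeff_map, and_comm]
  simp only [map_eq_zero, Polynomial.derivative_map, Polynomial.eval_map_algebraMap,
    ne_eq, ← imp_iff_not_or]
  refine and_congr Iff.rfl ?_
  have hle := natDegree_normalQuintic_le δ r
  constructor
  · intro hc
    by_cases h4 : (normalQuintic δ r).coeff 4 = 0
    · exact Or.inl (hle.antisymm (Polynomial.le_natDegree_of_ne_zero (hc h4)))
    · have := Polynomial.le_natDegree_of_ne_zero h4
      lia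
  · rintro (hd | hd) h4 h5
    · rw [← hd, Polynomial.coeff_natDegree, Polynomial.leadingCoeff_eq_zero] at h5
      simp [h5] at hd
    · have hd : (normalQuintic δ r).natDegree = 4 := by lia
      rw [← hd, Polynomial.coeff_natDegree, Polynomial.leadingCoeff_eq_zero] at h4
      simp [h4] at hd

end NormalCubic

section LinearSubst

variable {σ R S : Type*} [Fintype σ] [CommRing R] [CommRing S]

/-- The polynomial `F` precomposed with the linear map given by the matrix `M`. -/
noncomputable def linearSubst (M : Matrix σ σ R) (F : MvPolynomial σ R) : MvPolynomial σ R :=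
  bind₁ (fun j ↦ ∑ i, C (M j i) * X i) F

theorem eval_linearSubst (M : Matrix σ σ R) (F : MvPolynomial σ R) (v : σ → R) :
    eval v (linearSubst M F) = eval (M.mulVec v) F := by
  unfold linearSubst
  rw [eval, eval₂Hom_bind₁]
  congr 2
  funext j
  simp [Matrix.mulVec, dotProduct]

theorem map_linearSubst (f : R →+* S) (M : Matrix σ σ R) (F : MvPolynomial σ R) :
    map f (linearSubst M F) = linearSubst (M.map f) (map f F) := by
  unfold linearSubst
  rw [map_bind₁]
  simp

theorem linearSubst_linearSubst (M N : Matrix σ σ R) (F : MvPolynomial σ R) :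
    linearSubst M (linearSubst N F) = linearSubst (N * M) F := by
  unfold linearSubst
  rw [bind₁_bind₁]
  congr 2
  funext j
  simp only [map_sum, map_mul, bind₁_C_right, bind₁_X_right, Matrix.mul_apply, Finset.mul_sum,
    Finset.sum_mul, mul_assoc]
  exact Finset.sum_comm

theorem linearSubst_one [DecidableEq σ] (F : MvPolynomial σ R) : linearSubst 1 F = F := by
  unfold linearSubst
  have : (fun j : σ ↦ ∑ i, C ((1 : Matrix σ σ R) j i) * X i) = X := by
    funext j
    simp [Matrix.one_apply]
  rw [this, bind₁_X_left, AlgHom.id_apply]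

theorem linearSubst_injective [DecidableEq σ] {M : Matrix σ σ R} (hM : IsUnit M.det) :
    Function.Injective (linearSubst M) := by
  intro F G h
  have := congrArg (linearSubst M⁻¹) h
  rwa [linearSubst_linearSubst, linearSubst_linearSubst, Matrix.mul_nonsing_inv _ hM,
    linearSubst_one, linearSubst_one] at this

theorem MvPolynomial.IsHomogeneous.linearSubst {F : MvPolynomial σ R} {n : ℕ}
    (hF : F.IsHomogeneous n) (M : Matrix σ σ R) : (linearSubst M F).IsHomogeneous n := by
  have := hF.aeval (fun j : σ ↦ ∑ i, C (M j i) * X i) (n := 1) fun j ↦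
    IsHomogeneous.sum _ _ _ fun i _ ↦ (isHomogeneous_X R i).C_mul (M j i)
  rwa [one_mul] at this

theorem pderiv_linearSubst (M : Matrix σ σ R) (F : MvPolynomial σ R) (i : σ) :
    pderiv i (linearSubst M F) = ∑ j, C (M j i) * linearSubst M (pderiv j F) := by
  classical
  unfold linearSubst
  induction F using MvPolynomial.induction_on with
  | C a => simp
  | add p q hp hq => simp only [map_add, hp, hq, mul_add, Finset.sum_add_distrib]
  | mul_X p k hp =>
    simp only [map_mul, bind₁_X_right, Derivation.leibniz, smul_eq_mul, hp, map_sum, pderiv_C,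
      pderiv_X, mul_zero, add_zero, map_add, mul_add, Finset.sum_add_distrib, Finset.mul_sum]
    congr 1
    · simp [Pi.single_apply, mul_comm]
    · simp only [Finset.sum_mul, Finset.mul_sum]
      rw [Finset.sum_comm]
      exact Finset.sum_congr rfl fun j _ ↦ Finset.sum_congr rfl fun l _ ↦ by ring

theorem SmoothCubic.linearSubst {K : Type} [Field K] {F : MvPolynomial (Fin 4) K}
    (hF : SmoothCubic K F) {M : Matrix (Fin 4) (Fin 4) K} (hM : IsUnit M.det) :
    SmoothCubic K (linearSubst M F) := by
  intro v hv
  set φ := algebraMap K (AlgebraicClosure K)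
  have hM' : IsUnit (M.map φ).det := by
    have := hM.map φ
    rwa [RingHom.map_det] at this
  have hMv : (M.map φ).mulVec v ≠ 0 := fun h ↦
    hv (Matrix.mulVec_injective_of_isUnit ((Matrix.isUnit_iff_isUnit_det _).2 hM')
      (h.trans (Matrix.mulVec_zero _).symm))
  by_contra! h
  obtain ⟨i, hi⟩ := hF _ hMv
  have : Matrix.vecMul (fun j ↦ eval ((M.map φ).mulVec v) (pderiv j (map φ F))) (M.map φ) = 0 := by
    funext j
    have := h j
    rw [map_linearSubst, pderiv_linearSubst] at this
    simpa [eval_linearSubst, Matrix.vecMul, dotProduct, mul_comm] using this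
  exact hi (congrFun (Matrix.vecMul_injective_of_isUnit
    ((Matrix.isUnit_iff_isUnit_det _).2 hM') (this.trans (Matrix.zero_vecMul _).symm)) i)

theorem smoothCubic_linearSubst_iff {K : Type} [Field K] {F : MvPolynomial (Fin 4) K}
    {M : Matrix (Fin 4) (Fin 4) K} (hM : IsUnit M.det) :
    SmoothCubic K (linearSubst M F) ↔ SmoothCubic K F := by
  refine ⟨fun h ↦ ?_, fun h ↦ h.linearSubst hM⟩
  have := h.linearSubst (M.isUnit_nonsing_inv_det hM)
  rwa [linearSubst_linearSubst, Matrix.mul_nonsing_inv _ hM, linearSubst_one] at this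

end LinearSubst

section LineForm

variable {K : Type*} [Field K]

/-- The cubic form `x α + y β + 2 z Q₁ + 2 w Q₂ + R` where `α`, `β` are the quadratic forms in
`z`, `w` with coefficients `u`, `v`, and `Q₁`, `Q₂`, `R` are forms in `x`, `y` with
coefficients `r`. -/
noncomputable def lineForm (u v : Fin 3 → K) (r : Fin 10 → K) : MvPolynomial (Fin 4) K :=
  X 0 * (C (u 0) * X 2 ^ 2 + C (u 1) * X 2 * X 3 + C (u 2) * X 3 ^ 2) +
    X 1 * (C (v 0) * X 2 ^ 2 + C (v 1) * X 2 * X 3 + C (v 2) * X 3 ^ 2) +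
    C 2 * (C (r 0) * X 0 ^ 2 + C (r 1) * X 0 * X 1 + C (r 2) * X 1 ^ 2) * X 2 +
    C 2 * (C (r 3) * X 0 ^ 2 + C (r 4) * X 0 * X 1 + C (r 5) * X 1 ^ 2) * X 3 +
    (C (r 6) * X 0 ^ 3 + C (r 7) * X 0 ^ 2 * X 1 + C (r 8) * X 0 * X 1 ^ 2 + C (r 9) * X 1 ^ 3)

/-- The partial derivatives of `lineForm u v r` at a point. -/
def lineGradient (u v : Fin 3 → K) (r : Fin 10 → K) (p : Fin 4 → K) : Fin 4 → K :=
  ![u 0 * p 2 ^ 2 + u 1 * p 2 * p 3 + u 2 * p 3 ^ 2 + 2 * (2 * r 0 * p 0 + r 1 * p 1) * p 2 +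
      2 * (2 * r 3 * p 0 + r 4 * p 1) * p 3 +
      3 * r 6 * p 0 ^ 2 + 2 * r 7 * p 0 * p 1 + r 8 * p 1 ^ 2,
    v 0 * p 2 ^ 2 + v 1 * p 2 * p 3 + v 2 * p 3 ^ 2 + 2 * (r 1 * p 0 + 2 * r 2 * p 1) * p 2 +
      2 * (r 4 * p 0 + 2 * r 5 * p 1) * p 3 +
      r 7 * p 0 ^ 2 + 2 * r 8 * p 0 * p 1 + 3 * r 9 * p 1 ^ 2,
    p 0 * (2 * u 0 * p 2 + u 1 * p 3) + p 1 * (2 * v 0 * p 2 + v 1 * p 3) +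
      2 * (r 0 * p 0 ^ 2 + r 1 * p 0 * p 1 + r 2 * p 1 ^ 2),
    p 0 * (u 1 * p 2 + 2 * u 2 * p 3) + p 1 * (v 1 * p 2 + 2 * v 2 * p 3) +
      2 * (r 3 * p 0 ^ 2 + r 4 * p 0 * p 1 + r 5 * p 1 ^ 2)]

theorem eval_lineForm (u v : Fin 3 → K) (r : Fin 10 → K) (p : Fin 4 → K) :
    eval p (lineForm u v r) =
      p 0 * (u 0 * p 2 ^ 2 + u 1 * p 2 * p 3 + u 2 * p 3 ^ 2) +
        p 1 * (v 0 * p 2 ^ 2 + v 1 * p 2 * p 3 + v 2 * p 3 ^ 2) +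
        2 * (r 0 * p 0 ^ 2 + r 1 * p 0 * p 1 + r 2 * p 1 ^ 2) * p 2 +
        2 * (r 3 * p 0 ^ 2 + r 4 * p 0 * p 1 + r 5 * p 1 ^ 2) * p 3 +
        (r 6 * p 0 ^ 3 + r 7 * p 0 ^ 2 * p 1 + r 8 * p 0 * p 1 ^ 2 + r 9 * p 1 ^ 3) := by
  simp [lineForm]

theorem eval_pderiv_lineForm (u v : Fin 3 → K) (r : Fin 10 → K) (p : Fin 4 → K) (i : Fin 4) :
    eval p (pderiv i (lineForm u v r)) = lineGradient u v r p i := by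
  have h : ∀ i j : Fin 4, pderiv i (X j : MvPolynomial (Fin 4) K) = if j = i then 1 else 0 := by
    intro i j
    rw [pderiv_X, Pi.single_apply]
  fin_cases i <;>
    simp [lineForm, lineGradient, h, Derivation.leibniz, Derivation.leibniz_pow] <;> ring

theorem map_lineForm {L : Type*} [Field L] (f : K →+* L) (u v : Fin 3 → K) (r : Fin 10 → K) :
    map f (lineForm u v r) =
      lineForm (fun i ↦ f (u i)) (fun i ↦ f (v i)) (fun i ↦ f (r i)) := by
  simp [lineForm, map_ofNat f 2]

theorem smoothCubic_lineForm_iff {K : Type} [Field K] (u v : Fin 3 → K) (r : Fin 10 → K) :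
    SmoothCubic K (lineForm u v r) ↔ ∀ p : Fin 4 → AlgebraicClosure K, p ≠ 0 →
      lineGradient (fun i ↦ algebraMap K (AlgebraicClosure K) (u i))
        (fun i ↦ algebraMap K (AlgebraicClosure K) (v i))
        (fun i ↦ algebraMap K (AlgebraicClosure K) (r i)) p ≠ 0 := by
  simp only [SmoothCubic, map_lineForm, eval_pderiv_lineForm, Function.ne_iff, Pi.zero_apply]

theorem isHomogeneous_lineForm (u v : Fin 3 → K) (r : Fin 10 → K) :
    (lineForm u v r).IsHomogeneous 3 := by
  have hx : ∀ i, (X i : MvPolynomial (Fin 4) K).IsHomogeneous 1 := isHomogeneous_X K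
  have hx2 : ∀ i, (X i ^ 2 : MvPolynomial (Fin 4) K).IsHomogeneous 2 :=
    fun i ↦ isHomogeneous_X_pow i 2
  have hx3 : ∀ i, (X i ^ 3 : MvPolynomial (Fin 4) K).IsHomogeneous 3 :=
    fun i ↦ isHomogeneous_X_pow i 3
  have h2 : ∀ (a b c : K) (i j : Fin 4),
      (C a * X i ^ 2 + C b * X i * X j + C c * X j ^ 2).IsHomogeneous 2 := fun a b c i j ↦
    (((hx2 i).C_mul a).add (((hx i).C_mul b).mul (hx j))).add ((hx2 j).C_mul c)
  exact (((((hx 0).mul (h2 _ _ _ _ _)).add ((hx 1).mul (h2 _ _ _ _ _))).add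
    (((h2 _ _ _ _ _).C_mul 2).mul (hx 2))).add (((h2 _ _ _ _ _).C_mul 2).mul (hx 3))).add
    (((((hx3 0).C_mul _).add (((hx2 0).C_mul _).mul (hx 1))).add
      (((hx 0).C_mul _).mul (hx2 1))).add ((hx3 1).C_mul _))

theorem lineForm_sub (u v u' v' : Fin 3 → K) (r r' : Fin 10 → K) :
    lineForm u v r - lineForm u' v' r' = lineForm (u - u') (v - v') (r - r') := by
  simp only [lineForm, Pi.sub_apply, map_sub]
  ring

theorem lineForm_inj (h2 : (2 : K) ≠ 0) {u v u' v' : Fin 3 → K} {r r' : Fin 10 → K}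
    (h : lineForm u v r = lineForm u' v' r') : u = u' ∧ v = v' ∧ r = r' := by
  rw [← sub_eq_zero, lineForm_sub] at h
  rw [← sub_eq_zero, ← sub_eq_zero (a := v), ← sub_eq_zero (a := r)]
  generalize u - u' = u at *
  generalize v - v' = v at *
  generalize r - r' = r at *
  have he : ∀ p, eval p (lineForm u v r) = 0 := fun p ↦ by rw [h, map_zero]
  have hd : ∀ i p, lineGradient u v r p i = 0 := fun i p ↦ by
    rw [← eval_pderiv_lineForm, h, map_zero, map_zero]
  have quad : ∀ a b c : K, (∀ z w : K, a * z ^ 2 + b * z * w + c * w ^ 2 = 0) →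
      a = 0 ∧ b = 0 ∧ c = 0 := by
    intro a b c h
    have h0 := h 1 0
    have h1 := h 0 1
    have h3 := h 1 1
    simp at h0 h1
    simp [h0, h1] at h3
    exact ⟨h0, h3, h1⟩
  obtain ⟨u0, u1, u2⟩ := quad _ _ _ fun z w ↦ by simpa [lineGradient] using hd 0 ![0, 0, z, w]
  obtain ⟨v0, v1, v2⟩ := quad _ _ _ fun z w ↦ by simpa [lineGradient] using hd 1 ![0, 0, z, w]
  obtain ⟨r0, r1, r2⟩ := quad _ _ _ fun z w ↦ by
    simpa [lineGradient, h2] using hd 2 ![z, w, 0, 0]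
  obtain ⟨r3, r4, r5⟩ := quad _ _ _ fun z w ↦ by
    simpa [lineGradient, h2] using hd 3 ![z, w, 0, 0]
  have hc : ∀ x y : K, r 6 * x ^ 3 + r 7 * x ^ 2 * y + r 8 * x * y ^ 2 + r 9 * y ^ 3 = 0 :=
    fun x y ↦ by simpa [eval_lineForm] using he ![x, y, 0, 0]
  have r6 : r 6 = 0 := by simpa using hc 1 0
  have r9 : r 9 = 0 := by simpa using hc 0 1
  have c1 := hc 1 1
  have c2 := hc 1 (-1)
  have r8 : r 8 = 0 := (mul_eq_zero.1 (?_ : 2 * _ = (0 : K))).resolve_left h2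
  have r7 : r 7 = 0 := by linear_combination c1 - r6 - r8 - r9
  · refine ⟨?_, ?_, ?_⟩ <;> funext i <;> fin_cases i <;> assumption
  · linear_combination c1 + c2 - 2 * r6

theorem MvPolynomial.IsHomogeneous.eq_sum_antidiagonalTuple {R : Type*} [CommSemiring R]
    {m n : ℕ} {F : MvPolynomial (Fin m) R} (hF : F.IsHomogeneous n) :
    F = ∑ t ∈ Finset.Nat.antidiagonalTuple m n,
      C (coeff (Finsupp.equivFunOnFinite.symm t) F) * ∏ i, X i ^ t i := by
  have hs : F.support ⊆ (Finset.Nat.antidiagonalTuple m n).map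
      Finsupp.equivFunOnFinite.symm.toEmbedding := by
    intro d hd
    rw [Finset.mem_map_equiv, Equiv.symm_symm, Finset.Nat.mem_antidiagonalTuple]
    have := hF (mem_support_iff.1 hd)
    rw [Finsupp.weight_apply, Finsupp.sum_fintype _ _ (by simp)] at this
    simpa using this
  conv_lhs => rw [F.as_sum]
  rw [Finset.sum_subset hs fun d _ hd ↦ by rw [notMem_support_iff.1 hd, map_zero],
    Finset.sum_map]
  refine Finset.sum_congr rfl fun t _ ↦ ?_
  rw [monomial_eq, Finsupp.prod_fintype _ _ (by simp)]
  simp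

theorem exists_eq_lineForm (h2 : (2 : K) ≠ 0) {F : MvPolynomial (Fin 4) K}
    (hF : F.IsHomogeneous 3) (h : ∀ z w, eval ![0, 0, z, w] F = 0) :
    ∃ u v r, F = lineForm u v r := by
  have expand := hF.eq_sum_antidiagonalTuple
  have tuples : Finset.Nat.antidiagonalTuple 4 3 =
      {![0, 0, 0, 3], ![0, 0, 1, 2], ![0, 0, 2, 1], ![0, 0, 3, 0],
      ![0, 1, 0, 2], ![0, 1, 1, 1], ![0, 1, 2, 0], ![0, 2, 0, 1], ![0, 2, 1, 0], ![0, 3, 0, 0],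
      ![1, 0, 0, 2], ![1, 0, 1, 1], ![1, 0, 2, 0], ![1, 1, 0, 1], ![1, 1, 1, 0], ![1, 2, 0, 0],
      ![2, 0, 0, 1], ![2, 0, 1, 0], ![2, 1, 0, 0], ![3, 0, 0, 0]} := by
    decide
  obtain ⟨f, hf⟩ : ∃ f : (Fin 4 → ℕ) → K, ∀ t, coeff (Finsupp.equivFunOnFinite.symm t) F = f t :=
    ⟨_, fun _ ↦ rfl⟩
  simp only [hf] at expand
  have half : ∀ a : K, a = 2 * (a / 2) := fun a ↦ by field_simp
  have key : F = (C (f ![0, 0, 3, 0]) * X 2 ^ 3 + C (f ![0, 0, 2, 1]) * X 2 ^ 2 * X 3 +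
      C (f ![0, 0, 1, 2]) * X 2 * X 3 ^ 2 + C (f ![0, 0, 0, 3]) * X 3 ^ 3) +
      lineForm ![f ![1, 0, 2, 0], f ![1, 0, 1, 1], f ![1, 0, 0, 2]]
        ![f ![0, 1, 2, 0], f ![0, 1, 1, 1], f ![0, 1, 0, 2]]
        ![f ![2, 0, 1, 0] / 2, f ![1, 1, 1, 0] / 2, f ![0, 2, 1, 0] / 2,
          f ![2, 0, 0, 1] / 2, f ![1, 1, 0, 1] / 2, f ![0, 2, 0, 1] / 2,
          f ![3, 0, 0, 0], f ![2, 1, 0, 0], f ![1, 2, 0, 0], f ![0, 3, 0, 0]] := by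
    rw [expand, tuples]
    have hc : ∀ a : K, (C 2 : MvPolynomial (Fin 4) K) * C (a / 2) = C a := fun a ↦ by
      rw [← C_mul, ← half]
    simp only [lineForm, mul_add, ← mul_assoc]
    simp only [Matrix.cons_val, hc]
    simp [Fin.prod_univ_four]
    ring
  have e : ∀ z w, f ![0, 0, 3, 0] * z ^ 3 + f ![0, 0, 2, 1] * z ^ 2 * w +
      f ![0, 0, 1, 2] * z * w ^ 2 + f ![0, 0, 0, 3] * w ^ 3 = 0 := fun z w ↦ by
    have := h z w
    rw [key, map_add, eval_lineForm] at this
    simpa using this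
  have c0 : f ![0, 0, 3, 0] = 0 := by simpa using e 1 0
  have c3 : f ![0, 0, 0, 3] = 0 := by simpa using e 0 1
  have e1 := e 1 1
  have c2 : f ![0, 0, 1, 2] = 0 := by
    refine (mul_eq_zero.1 (?_ : 2 * _ = (0 : K))).resolve_left h2
    linear_combination e1 + e 1 (-1) - 2 * c0
  have c1 : f ![0, 0, 2, 1] = 0 := by linear_combination e1 - c0 - c2 - c3
  rw [c0, c1, c2, c3] at key
  simp only [map_zero, zero_mul, zero_add] at key
  exact ⟨_, _, _, key⟩

end LineForm

section Pencil

variable {K : Type} [Field K]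

theorem lineGradient_normal {L : Type*} [Field L] (δ : L) (r : Fin 10 → L) (p : Fin 4 → L) :
    lineGradient ![1, 0, δ] ![0, 2, 0] r p = normalGradient δ r (p 0) (p 1) (p 2) (p 3) := by
  funext i
  fin_cases i <;> simp [lineGradient, normalGradient] <;> ring

theorem smoothCubic_normal_iff [Fintype K] (h2 : (2 : K) ≠ 0) (h3 : (3 : K) ≠ 0) {δ : K}
    (hδ : δ ≠ 0) (r : Fin 10 → K) :
    SmoothCubic K (lineForm ![1, 0, δ] ![0, 2, 0] r) ↔
      normalQuintic δ r ∈ squarefreePolys K 5 := by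
  rw [smoothCubic_lineForm_iff,
    ← forall_normalGradient_ne_zero_iff (L := AlgebraicClosure K) h2 h3 hδ]
  have hu : (fun i ↦ algebraMap K (AlgebraicClosure K) (![1, 0, δ] i)) =
      ![1, 0, algebraMap K (AlgebraicClosure K) δ] := by
    funext i
    fin_cases i <;> simp
  have hv : (fun i ↦ algebraMap K (AlgebraicClosure K) (![0, 2, 0] i)) = ![0, 2, 0] := by
    funext i
    fin_cases i <;> simp [map_ofNat (algebraMap K (AlgebraicClosure K)) 2]
  simp only [hu, hv, lineGradient_normal]

/-- The discriminant of the resultant form of the pencil of binary quadratic forms spanned by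
`u` and `v`. -/
def pencilDisc {R : Type*} [CommRing R] (u v : Fin 3 → R) : R :=
  (u 2 * v 0 - u 0 * v 2) ^ 2 - (u 1 * v 2 - u 2 * v 1) * (u 0 * v 1 - u 1 * v 0)

theorem map_pencilDisc {R S : Type*} [CommRing R] [CommRing S] (f : R →+* S) (u v : Fin 3 → R) :
    pencilDisc (fun i ↦ f (u i)) (fun i ↦ f (v i)) = f (pencilDisc u v) := by
  simp [pencilDisc]

theorem exists_common_zero_of_pencilDisc_eq_zero {L : Type*} [Field L] [IsAlgClosed L]
    (h2 : (2 : L) ≠ 0) {u v : Fin 3 → L} (h : pencilDisc u v = 0) :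
    ∃ z w : L, (z ≠ 0 ∨ w ≠ 0) ∧ u 0 * z ^ 2 + u 1 * z * w + u 2 * w ^ 2 = 0 ∧
      v 0 * z ^ 2 + v 1 * z * w + v 2 * w ^ 2 = 0 := by
  unfold pencilDisc at h
  have root : ∀ a b c : L, ∃ z w : L, (z ≠ 0 ∨ w ≠ 0) ∧ a * z ^ 2 + b * z * w + c * w ^ 2 = 0 := by
    intro a b c
    by_cases ha : a = 0
    · exact ⟨1, 0, by simp, by simp [ha]⟩
    · have : NeZero (2 : L) := ⟨h2⟩
      obtain ⟨s, hs⟩ := IsAlgClosed.exists_pow_nat_eq (discrim a b c) two_pos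
      obtain ⟨z, hz⟩ := exists_quadratic_eq_zero ha ⟨s, by rw [← sq, hs]⟩
      exact ⟨z, 1, by simp, by linear_combination hz⟩
  by_cases hw0 : u 1 * v 2 - u 2 * v 1 = 0
  · have hw1 : u 2 * v 0 - u 0 * v 2 = 0 := by
      rw [hw0, zero_mul, sub_zero] at h
      exact pow_eq_zero_iff two_ne_zero |>.1 h
    by_cases hw2 : u 0 * v 1 - u 1 * v 0 = 0
    · by_cases hu : u = 0
      · obtain ⟨z, w, hzw, e⟩ := root (v 0) (v 1) (v 2)
        exact ⟨z, w, hzw, by simp [hu], e⟩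
      · obtain ⟨z, w, hzw, e⟩ := root (u 0) (u 1) (u 2)
        refine ⟨z, w, hzw, e, ?_⟩
        obtain ⟨i, hi⟩ := Function.ne_iff.1 hu
        refine (mul_eq_zero.1 (?_ : u i * _ = (0 : L))).resolve_left hi
        fin_cases i
        · change u 0 * _ = 0
          linear_combination v 0 * e + z * w * hw2 - w ^ 2 * hw1
        · change u 1 * _ = 0
          linear_combination v 1 * e - z ^ 2 * hw2 + w ^ 2 * hw0
        · change u 2 * _ = 0
          linear_combination v 2 * e + z ^ 2 * hw1 - z * w * hw0
    · refine ⟨0, 1, by simp, ?_, ?_⟩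
      · simp
        refine (mul_eq_zero.1 (?_ : (u 0 * v 1 - u 1 * v 0) * _ = (0 : L))).resolve_left hw2
        linear_combination -u 0 * hw0 - u 1 * hw1
      · simp
        refine (mul_eq_zero.1 (?_ : (u 0 * v 1 - u 1 * v 0) * _ = (0 : L))).resolve_left hw2
        linear_combination -v 0 * hw0 - v 1 * hw1
  · refine ⟨u 1 * v 2 - u 2 * v 1, u 2 * v 0 - u 0 * v 2, Or.inl hw0, ?_, ?_⟩
    · linear_combination u 2 * h
    · linear_combination v 2 * h

theorem not_smoothCubic_of_pencilDisc_eq_zero (h2 : (2 : K) ≠ 0) {u v : Fin 3 → K}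
    (h : pencilDisc u v = 0) (r : Fin 10 → K) : ¬ SmoothCubic K (lineForm u v r) := by
  have h2' : (2 : AlgebraicClosure K) ≠ 0 :=
    map_ofNat (algebraMap K (AlgebraicClosure K)) 2 ▸ (map_ne_zero _).2 h2
  rw [smoothCubic_lineForm_iff]
  push Not
  obtain ⟨z, w, hzw, hu, hv⟩ := exists_common_zero_of_pencilDisc_eq_zero h2'
    (by rw [map_pencilDisc, h, map_zero] :
      pencilDisc (fun i ↦ algebraMap K (AlgebraicClosure K) (u i))
        (fun i ↦ algebraMap K (AlgebraicClosure K) (v i)) = 0)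
  refine ⟨![0, 0, z, w], ?_, ?_⟩
  · intro h
    have hz : z = 0 := congrFun h 2
    have hw : w = 0 := congrFun h 3
    tauto
  · funext i
    fin_cases i
    · simpa [lineGradient] using hu
    · simpa [lineGradient] using hv
    · simp [lineGradient]
    · simp [lineGradient]

/-- The block diagonal linear substitution acting by `g` on `x`, `y` and by `h` on `z`, `w`. -/
def blockSubst {R : Type*} [CommRing R] (g h : Matrix (Fin 2) (Fin 2) R) :
    Matrix (Fin 4) (Fin 4) R :=
  !![g 0 0, g 0 1, 0, 0; g 1 0, g 1 1, 0, 0; 0, 0, h 0 0, h 0 1; 0, 0, h 1 0, h 1 1]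

theorem det_blockSubst {R : Type*} [CommRing R] (g h : Matrix (Fin 2) (Fin 2) R) :
    (blockSubst g h).det = g.det * h.det := by
  simp [blockSubst, Matrix.det_succ_row_zero, Fin.sum_univ_succ, Fin.succAbove]
  ring

/-- The quadratic form with coefficients `u` after the linear substitution `h`. -/
def quadSubst {R : Type*} [CommRing R] (h : Matrix (Fin 2) (Fin 2) R) (u : Fin 3 → R) :
    Fin 3 → R :=
  ![u 0 * h 0 0 ^ 2 + u 1 * h 0 0 * h 1 0 + u 2 * h 1 0 ^ 2,
    2 * u 0 * h 0 0 * h 0 1 + u 1 * (h 0 0 * h 1 1 + h 0 1 * h 1 0) + 2 * u 2 * h 1 0 * h 1 1,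
    u 0 * h 0 1 ^ 2 + u 1 * h 0 1 * h 1 1 + u 2 * h 1 1 ^ 2]

theorem exists_linearSubst_blockSubst_lineForm (g h : Matrix (Fin 2) (Fin 2) K) (u v : Fin 3 → K)
    (r : Fin 10 → K) : ∃ r', linearSubst (blockSubst g h) (lineForm u v r) =
      lineForm (g 0 0 • quadSubst h u + g 1 0 • quadSubst h v)
        (g 0 1 • quadSubst h u + g 1 1 • quadSubst h v) r' := by
  set q₁ := quadSubst g ![r 0, r 1, r 2] with hq₁
  set q₂ := quadSubst g ![r 3, r 4, r 5] with hq₂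
  refine ⟨![h 0 0 * q₁ 0 + h 1 0 * q₂ 0, h 0 0 * q₁ 1 + h 1 0 * q₂ 1,
    h 0 0 * q₁ 2 + h 1 0 * q₂ 2, h 0 1 * q₁ 0 + h 1 1 * q₂ 0, h 0 1 * q₁ 1 + h 1 1 * q₂ 1,
    h 0 1 * q₁ 2 + h 1 1 * q₂ 2,
    r 6 * g 0 0 ^ 3 + r 7 * g 0 0 ^ 2 * g 1 0 + r 8 * g 0 0 * g 1 0 ^ 2 + r 9 * g 1 0 ^ 3,
    3 * r 6 * g 0 0 ^ 2 * g 0 1 + r 7 * (2 * g 0 0 * g 0 1 * g 1 0 + g 0 0 ^ 2 * g 1 1) +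
      r 8 * (g 0 1 * g 1 0 ^ 2 + 2 * g 0 0 * g 1 0 * g 1 1) + 3 * r 9 * g 1 0 ^ 2 * g 1 1,
    3 * r 6 * g 0 0 * g 0 1 ^ 2 + r 7 * (g 0 1 ^ 2 * g 1 0 + 2 * g 0 0 * g 0 1 * g 1 1) +
      r 8 * (2 * g 0 1 * g 1 0 * g 1 1 + g 0 0 * g 1 1 ^ 2) + 3 * r 9 * g 1 0 * g 1 1 ^ 2,
    r 6 * g 0 1 ^ 3 + r 7 * g 0 1 ^ 2 * g 1 1 + r 8 * g 0 1 * g 1 1 ^ 2 + r 9 * g 1 1 ^ 3], ?_⟩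
  simp only [hq₁, hq₂, linearSubst, lineForm, quadSubst, blockSubst, map_add, map_mul, map_pow,
    bind₁_X_right, bind₁_C_right, Fin.sum_univ_four, Matrix.of_apply, Matrix.cons_val,
    Pi.add_apply, Pi.smul_apply, smul_eq_mul, map_zero, zero_mul, add_zero, zero_add]
  simp only [show (C (2 : K) : MvPolynomial (Fin 4) K) = 2 from map_ofNat C 2,
    show (C (3 : K) : MvPolynomial (Fin 4) K) = 3 from map_ofNat C 3]
  ring

variable [Fintype K]

/-- The number of smooth cubic forms whose restriction to the first order neighbourhood of the
line `x = y = 0` is given by the pencil spanned by `u` and `v`. -/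
noncomputable def pencilCount (u v : Fin 3 → K) : ℕ :=
  Nat.card {r : Fin 10 → K // SmoothCubic K (lineForm u v r)}

theorem pencilCount_blockSubst (h2 : (2 : K) ≠ 0) {g h : Matrix (Fin 2) (Fin 2) K}
    (hg : g.det ≠ 0) (hh : h.det ≠ 0) (u v : Fin 3 → K) :
    pencilCount (g 0 0 • quadSubst h u + g 1 0 • quadSubst h v)
      (g 0 1 • quadSubst h u + g 1 1 • quadSubst h v) = pencilCount u v := by
  choose f hf using exists_linearSubst_blockSubst_lineForm g h u v
  have hM : IsUnit (blockSubst g h).det := by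
    rw [det_blockSubst]
    exact (mul_ne_zero hg hh).isUnit
  have hinj : Function.Injective f := fun r r' e ↦
    (lineForm_inj h2 (linearSubst_injective hM ((hf r).trans (e ▸ (hf r').symm)))).2.2
  refine (Nat.card_congr ((Equiv.ofBijective f (Finite.injective_iff_bijective.1 hinj)).subtypeEquiv
    fun r ↦ ?_)).symm
  rw [Equiv.ofBijective_apply, ← hf, smoothCubic_linearSubst_iff hM]

theorem pencilCount_normal (h2 : (2 : K) ≠ 0) (h3 : (3 : K) ≠ 0) {δ : K} (hδ : δ ≠ 0) :
    pencilCount ![1, 0, δ] ![0, 2, 0] = Fintype.card K ^ 4 * (squarefreePolys K 5).card := by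
  rw [← card_normalQuintic hδ h2]
  exact Nat.card_congr (Equiv.subtypeEquivRight fun r ↦ smoothCubic_normal_iff h2 h3 hδ r)

theorem pencilCount_of_minor_ne_zero (h2 : (2 : K) ≠ 0) (h3 : (3 : K) ≠ 0) {u v : Fin 3 → K}
    (hd : pencilDisc u v ≠ 0) (hw : u 0 * v 1 - u 1 * v 0 ≠ 0) :
    pencilCount u v = Fintype.card K ^ 4 * (squarefreePolys K 5).card := by
  obtain ⟨W, hW⟩ : ∃ W, W = u 0 * v 1 - u 1 * v 0 := ⟨_, rfl⟩
  rw [← hW] at hw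
  set t := (u 0 * v 2 - u 2 * v 0) / W with ht
  have hδ : pencilDisc u v / W ^ 2 ≠ 0 := div_ne_zero hd (pow_ne_zero 2 hw)
  have hh : (!![1, t; 0, 1] : Matrix (Fin 2) (Fin 2) K).det ≠ 0 := by
    simp [Matrix.det_fin_two]
  have hg : (!![u 0, v 0; (u 1 - 2 * t * u 0) / 2, (v 1 - 2 * t * v 0) / 2] :
      Matrix (Fin 2) (Fin 2) K).det ≠ 0 := by
    rw [Matrix.det_fin_two]
    simp only [Matrix.of_apply, Matrix.cons_val]
    intro h
    exact hw (by field_simp at h; linear_combination hW + h)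
  rw [← pencilCount_normal h2 h3 hδ, ← pencilCount_blockSubst h2 hg hh ![1, 0, _]]
  congr 1 <;> funext i <;> fin_cases i <;> simp [quadSubst]
  all_goals
    simp only [pencilDisc, ht]
    field_simp
    simp only [hW]
    ring

theorem pencilCount_of_pencilDisc_ne_zero (h2 : (2 : K) ≠ 0) (h3 : (3 : K) ≠ 0) {u v : Fin 3 → K}
    (hd : pencilDisc u v ≠ 0) :
    pencilCount u v = Fintype.card K ^ 4 * (squarefreePolys K 5).card := by
  by_cases hw : u 0 * v 1 - u 1 * v 0 = 0
  · have shear : ∀ t : K, t * (-2 * (u 2 * v 0 - u 0 * v 2) + t * (u 1 * v 2 - u 2 * v 1)) ≠ 0 →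
        pencilCount u v = Fintype.card K ^ 4 * (squarefreePolys K 5).card := by
      intro t ht
      have hh : (!![1, 0; t, 1] : Matrix (Fin 2) (Fin 2) K).det ≠ 0 := by
        simp [Matrix.det_fin_two]
      have hg : (1 : Matrix (Fin 2) (Fin 2) K).det ≠ 0 := by simp
      rw [← pencilCount_blockSubst h2 hg hh]
      simp only [Matrix.one_apply_eq, one_smul, zero_smul, add_zero, zero_add, ne_eq, zero_ne_one,
        one_ne_zero, not_false_eq_true, Matrix.one_apply_ne]
      refine pencilCount_of_minor_ne_zero h2 h3 ?_ ?_
      · convert hd using 1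
        simp [quadSubst, pencilDisc]
        ring
      · convert ht using 1
        simp [quadSubst]
        linear_combination hw
    have hw1 : u 2 * v 0 - u 0 * v 2 ≠ 0 := fun h ↦ hd (by rw [pencilDisc, hw, h]; ring)
    by_cases ht : (1 : K) * (-2 * (u 2 * v 0 - u 0 * v 2) + 1 * (u 1 * v 2 - u 2 * v 1)) = 0
    · refine shear (-1) fun h ↦ mul_ne_zero (mul_ne_zero h2 h2) hw1 ?_
      linear_combination h - ht
    · exact shear 1 ht
  · exact pencilCount_of_minor_ne_zero h2 h3 hd hw

end Pencil

section CountPencils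

variable {K : Type} [Field K] [Fintype K]

theorem card_det_ne_zero :
    Nat.card {m : Matrix (Fin 2) (Fin 2) K // m.det ≠ 0} =
      (Fintype.card K ^ 2 - 1) * (Fintype.card K ^ 2 - Fintype.card K) := by
  have h := card_linearIndependent (K := K) (V := Fin 2 → K) (k := 2) (by simp)
  simp only [Module.finrank_fintype_fun_eq_card, Fintype.card_fin, Fin.prod_univ_two,
    Fin.val_zero, Fin.val_one, pow_zero, pow_one] at h
  rw [← h]
  refine Nat.card_congr (Matrix.of.symm.subtypeEquiv fun m ↦ ?_)
  rw [← isUnit_iff_ne_zero, ← Matrix.isUnit_iff_isUnit_det,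
    ← Matrix.linearIndependent_rows_iff_isUnit]
  rfl

theorem card_sq_add_ne_zero :
    Nat.card {p : K × K // p.1 ^ 2 + p.2 ≠ 0} = Fintype.card K * (Fintype.card K - 1) := by
  classical
  have e : {p : K × K // p.1 ^ 2 + p.2 ≠ 0} ≃ K × {x : K // x ≠ 0} :=
    { toFun := fun p ↦ (p.1.1, ⟨_, p.2⟩)
      invFun := fun p ↦ ⟨(p.1, p.2 - p.1 ^ 2), by simpa using p.2.2⟩
      left_inv := fun p ↦ by simp
      right_inv := fun p ↦ by simp }
  rw [Nat.card_congr e, Nat.card_prod, Nat.card_eq_fintype_card, Nat.card_eq_fintype_card,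
    ← Fintype.card_units, Fintype.card_congr (unitsEquivNeZero (G₀ := K))]

theorem card_pencilDisc_ne_zero :
    Nat.card {p : (Fin 3 → K) × (Fin 3 → K) // pencilDisc p.1 p.2 ≠ 0} =
      (Fintype.card K ^ 2 - 1) * (Fintype.card K ^ 2 - Fintype.card K) * Fintype.card K ^ 2 := by
  let f : {m : Matrix (Fin 2) (Fin 2) K // m.det ≠ 0} × {p : K × K // p.1 ^ 2 + p.2 ≠ 0} →
      {p : (Fin 3 → K) × (Fin 3 → K) // pencilDisc p.1 p.2 ≠ 0} := fun x ↦
    ⟨(![x.1.1 0 0, x.1.1 0 1, x.1.1 0 0 * x.2.1.2 + x.2.1.1 * x.1.1 0 1],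
      ![x.1.1 1 0, x.1.1 1 1, x.1.1 1 0 * x.2.1.2 + x.2.1.1 * x.1.1 1 1]), by
      convert mul_ne_zero (pow_ne_zero 2 x.1.2) x.2.2 using 1
      simp [pencilDisc, Matrix.det_fin_two]
      ring⟩
  let g : {m : Matrix (Fin 2) (Fin 2) K // m.det ≠ 0} × K →
      {p : (Fin 3 → K) × (Fin 3 → K) // pencilDisc p.1 p.2 ≠ 0} := fun x ↦
    ⟨(![x.1.1 0 0, x.2 * x.1.1 0 0, x.1.1 0 1], ![x.1.1 1 0, x.2 * x.1.1 1 0, x.1.1 1 1]), by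
      convert pow_ne_zero 2 x.1.2 using 1
      simp [pencilDisc, Matrix.det_fin_two]
      ring⟩
  have hf : Function.Injective f := by
    rintro ⟨⟨m, hm⟩, ⟨⟨t, D⟩, hp⟩⟩ ⟨⟨m', hm'⟩, ⟨⟨t', D'⟩, hp'⟩⟩ h
    have h1 := congrArg (fun z ↦ z.1.1) h
    have h2 := congrArg (fun z ↦ z.1.2) h
    have a := congrFun h1 0
    have b := congrFun h1 1
    have e := congrFun h1 2
    have c := congrFun h2 0
    have d := congrFun h2 1
    have e' := congrFun h2 2
    simp [f] at a b c d e e'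
    obtain rfl : m = m' := by
      ext i j
      fin_cases i <;> fin_cases j <;> assumption
    rw [Matrix.det_fin_two] at hm
    obtain rfl : D = D' := sub_eq_zero.1 <| (mul_eq_zero.1 (by
      linear_combination m 1 1 * e - m 0 1 * e' :
        (m 0 0 * m 1 1 - m 0 1 * m 1 0) * (D - D') = 0)).resolve_left hm
    obtain rfl : t = t' := sub_eq_zero.1 <| (mul_eq_zero.1 (by
      linear_combination m 0 0 * e' - m 1 0 * e :
        (m 0 0 * m 1 1 - m 0 1 * m 1 0) * (t - t') = 0)).resolve_left hm
    rfl
  have hg : Function.Injective g := by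
    rintro ⟨⟨m, hm⟩, t⟩ ⟨⟨m', hm'⟩, t'⟩ h
    have h1 := congrArg (fun z ↦ z.1.1) h
    have h2 := congrArg (fun z ↦ z.1.2) h
    have a := congrFun h1 0
    have b := congrFun h1 2
    have e := congrFun h1 1
    have c := congrFun h2 0
    have d := congrFun h2 2
    have e' := congrFun h2 1
    simp [g] at a b c d e e'
    obtain rfl : m = m' := by
      ext i j
      fin_cases i <;> fin_cases j <;> assumption
    rw [Matrix.det_fin_two] at hm
    obtain rfl : t = t' := sub_eq_zero.1 <| (mul_eq_zero.1 (by
      linear_combination m 1 1 * e - m 0 1 * e' :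
        (m 0 0 * m 1 1 - m 0 1 * m 1 0) * (t - t') = 0)).resolve_left hm
    rfl
  have hfg : ∀ x y, f x ≠ g y := by
    rintro ⟨⟨m, hm⟩, ⟨⟨t, D⟩, hp⟩⟩ ⟨⟨m', hm'⟩, t'⟩ h
    have h1 := congrArg (fun z ↦ z.1.1) h
    have h2 := congrArg (fun z ↦ z.1.2) h
    have a := congrFun h1 0
    have b := congrFun h1 1
    have c := congrFun h2 0
    have d := congrFun h2 1
    simp [f, g] at a b c d
    apply hm
    rw [Matrix.det_fin_two, a, b, c, d]
    ring
  have hs : Function.Surjective (Sum.elim f g) := by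
    rintro ⟨⟨u, v⟩, hd⟩
    by_cases hw : u 0 * v 1 - u 1 * v 0 = 0
    · have hw1 : u 0 * v 2 - u 2 * v 0 ≠ 0 := fun h ↦ hd (by
        simp only [pencilDisc]
        linear_combination (u 0 * v 2 - u 2 * v 0) * h - (u 1 * v 2 - u 2 * v 1) * hw)
      refine ⟨Sum.inr (⟨!![u 0, u 2; v 0, v 2], by simpa [Matrix.det_fin_two] using hw1⟩,
        (u 1 * v 2 - u 2 * v 1) / (u 0 * v 2 - u 2 * v 0)), Subtype.ext (Prod.ext ?_ ?_)⟩
      · funext i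
        fin_cases i
        · simp [g]
        · simp [g]
          rw [div_mul_eq_mul_div, div_eq_iff hw1]
          linear_combination -u 2 * hw
        · simp [g]
      · funext i
        fin_cases i
        · simp [g]
        · simp [g]
          rw [div_mul_eq_mul_div, div_eq_iff hw1]
          linear_combination -v 2 * hw
        · simp [g]
    · refine ⟨Sum.inl (⟨!![u 0, u 1; v 0, v 1], by simpa [Matrix.det_fin_two] using hw⟩,
        ⟨((u 0 * v 2 - u 2 * v 0) / (u 0 * v 1 - u 1 * v 0),
          (u 2 * v 1 - u 1 * v 2) / (u 0 * v 1 - u 1 * v 0)), ?_⟩), Subtype.ext (Prod.ext ?_ ?_)⟩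
      · intro h
        apply hd
        rw [div_pow, div_add_div _ _ (pow_ne_zero 2 hw) hw, div_eq_zero_iff,
          or_iff_left (mul_ne_zero (pow_ne_zero 2 hw) hw)] at h
        refine (mul_eq_zero.1 (?_ : (u 0 * v 1 - u 1 * v 0) * _ = 0)).resolve_left hw
        simp only [pencilDisc]
        linear_combination h
      · funext i
        fin_cases i
        · simp [f]
        · simp [f]
        · simp [f]
          rw [mul_div_assoc', div_mul_eq_mul_div, ← add_div, div_eq_iff hw]
          ring
      · funext i
        fin_cases i
        · simp [f]
        · simp [f]
        · simp [f]
          rw [mul_div_assoc', div_mul_eq_mul_div, ← add_div, div_eq_iff hw]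
          ring
  rw [← Nat.card_congr (Equiv.ofBijective _ ⟨hf.sumElim hg hfg, hs⟩), Nat.card_sum, Nat.card_prod,
    Nat.card_prod, card_det_ne_zero, card_sq_add_ne_zero, Nat.card_eq_fintype_card (α := K),
    ← mul_add]
  congr 1
  have := Fintype.card_pos (α := K)
  obtain ⟨q, hq⟩ := Nat.exists_eq_add_of_lt this
  rw [hq]
  simp
  ring

theorem sum_pencilCount (h2 : (2 : K) ≠ 0) (h3 : (3 : K) ≠ 0) :
    ∑ p : (Fin 3 → K) × (Fin 3 → K), pencilCount p.1 p.2 =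
      (Fintype.card K ^ 2 - 1) * (Fintype.card K ^ 2 - Fintype.card K) * Fintype.card K ^ 2 *
        (Fintype.card K ^ 4 * (squarefreePolys K 5).card) := by
  classical
  have h : ∀ p : (Fin 3 → K) × (Fin 3 → K), pencilCount p.1 p.2 =
      if pencilDisc p.1 p.2 ≠ 0 then Fintype.card K ^ 4 * (squarefreePolys K 5).card else 0 := by
    intro p
    split_ifs with hd
    · exact pencilCount_of_pencilDisc_ne_zero h2 h3 hd
    · rw [pencilCount, Nat.card_eq_zero]
      exact Or.inl ⟨fun r ↦ not_smoothCubic_of_pencilDisc_eq_zero h2 (not_not.1 hd) r.1 r.2⟩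
  rw [Finset.sum_congr rfl fun p _ ↦ h p, ← Finset.sum_filter, Finset.sum_const, smul_eq_mul,
    ← card_pencilDisc_ne_zero, Nat.card_eq_fintype_card, Fintype.card_subtype]

/-- The number of smooth cubic forms vanishing on the line `x = y = 0`. -/
theorem card_smooth_cubic_forms_vanishing_on_line (h2 : (2 : K) ≠ 0) (h3 : (3 : K) ≠ 0) :
    Nat.card {F : MvPolynomial (Fin 4) K // (F.IsHomogeneous 3 ∧ SmoothCubic K F) ∧
        ∀ z w, eval ![0, 0, z, w] F = 0} =
      (Fintype.card K ^ 2 - 1) * (Fintype.card K ^ 2 - Fintype.card K) * Fintype.card K ^ 2 *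
        (Fintype.card K ^ 4 * (squarefreePolys K 5).card) := by
  rw [← sum_pencilCount h2 h3]
  simp only [pencilCount]
  rw [← Nat.card_sigma]
  let f : (Σ p : (Fin 3 → K) × (Fin 3 → K), {r // SmoothCubic K (lineForm p.1 p.2 r)}) →
      {F : MvPolynomial (Fin 4) K // (F.IsHomogeneous 3 ∧ SmoothCubic K F) ∧
        ∀ z w, eval ![0, 0, z, w] F = 0} := fun x ↦
    ⟨lineForm x.1.1 x.1.2 x.2.1, ⟨isHomogeneous_lineForm _ _ _, x.2.2⟩,
      fun z w ↦ by simp [eval_lineForm]⟩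
  refine (Nat.card_congr (Equiv.ofBijective f ⟨?_, ?_⟩)).symm
  · rintro ⟨⟨u, v⟩, ⟨r, hr⟩⟩ ⟨⟨u', v'⟩, ⟨r', hr'⟩⟩ h
    obtain ⟨rfl, rfl, rfl⟩ := lineForm_inj h2 (congrArg Subtype.val h)
    rfl
  · rintro ⟨F, ⟨hF, hs⟩, h⟩
    obtain ⟨u, v, r, rfl⟩ := exists_eq_lineForm h2 hF h
    exact ⟨⟨(u, v), ⟨r, hs⟩⟩, rfl⟩

end CountPencils

section CountLines

variable {K : Type} [Field K]

theorem LinearIndependent.exists_isUnit_det_cols {m n : ℕ} {b : Fin n → Fin (m + n) → K}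
    (hb : LinearIndependent K b) : ∃ M : Matrix (Fin (m + n)) (Fin (m + n)) K,
      IsUnit M.det ∧ ∀ i, M.col (Fin.natAdd m i) = b i := by
  obtain ⟨W, hW⟩ := Submodule.exists_isCompl (Submodule.span K (Set.range b))
  have hfin : Module.finrank K W = m := by
    have h := Submodule.finrank_add_eq_of_isCompl hW
    rw [finrank_span_eq_card hb, Module.finrank_fintype_fun_eq_card, Fintype.card_fin,
      Fintype.card_fin] at h
    lia
  let c := (((Module.finBasisOfFinrankEq K W hfin).prod (Module.Basis.span hb)).map
    (Submodule.prodEquivOfIsCompl W _ hW.symm)).reindex finSumFinEquiv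
  refine ⟨Matrix.of fun i j ↦ c j i, ?_, fun i ↦ ?_⟩
  · rw [← Matrix.isUnit_iff_isUnit_det, ← Matrix.linearIndependent_cols_iff_isUnit]
    exact c.linearIndependent
  · funext k
    simp [c, Module.Basis.span_apply]

/-- Forms of degree three vanishing on a given plane correspond to those vanishing on the plane
`x = y = 0`. -/
theorem nonempty_equiv_forms_vanishing_on {ℓ : Submodule K (Fin 4 → K)}
    (hℓ : Module.finrank K ℓ = 2) :
    Nonempty ({F : MvPolynomial (Fin 4) K // (F.IsHomogeneous 3 ∧ SmoothCubic K F) ∧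
        ∀ v ∈ ℓ, eval v F = 0} ≃
      {F : MvPolynomial (Fin 4) K // (F.IsHomogeneous 3 ∧ SmoothCubic K F) ∧
        ∀ z w, eval ![0, 0, z, w] F = 0}) := by
  let b := Module.finBasisOfFinrankEq K ℓ hℓ
  have hb : LinearIndependent K fun i ↦ (b i : Fin 4 → K) :=
    b.linearIndependent.map' ℓ.subtype ℓ.ker_subtype
  obtain ⟨M, hM, hMb⟩ := hb.exists_isUnit_det_cols (m := 2)
  have hmul : ∀ z w : K, M.mulVec ![0, 0, z, w] = (z • b 0 + w • b 1 : ℓ) := by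
    intro z w
    simp only [Submodule.coe_add, Submodule.coe_smul, ← hMb]
    funext i
    simp [Matrix.mulVec, dotProduct, Fin.sum_univ_four, mul_comm]
  let e : MvPolynomial (Fin 4) K ≃ MvPolynomial (Fin 4) K :=
    { toFun := linearSubst M
      invFun := linearSubst M⁻¹
      left_inv := fun F ↦ by
        rw [linearSubst_linearSubst, Matrix.mul_nonsing_inv _ hM, linearSubst_one]
      right_inv := fun F ↦ by
        rw [linearSubst_linearSubst, Matrix.nonsing_inv_mul _ hM, linearSubst_one] }
  refine ⟨e.subtypeEquiv fun F ↦ and_congr (and_congr ?_ ?_) ?_⟩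
  · refine ⟨fun h ↦ h.linearSubst M, fun h ↦ ?_⟩
    rw [← e.symm_apply_apply F]
    exact h.linearSubst M⁻¹
  · exact (smoothCubic_linearSubst_iff hM).symm
  · simp only [e, Equiv.coe_fn_mk, eval_linearSubst, hmul]
    refine ⟨fun h z w ↦ h _ (Subtype.property _), fun h v hv ↦ ?_⟩
    have := b.sum_repr ⟨v, hv⟩
    rw [Fin.sum_univ_two] at this
    have h' := h (b.repr ⟨v, hv⟩ 0) (b.repr ⟨v, hv⟩ 1)
    rwa [this] at h'

theorem card_smooth_cubic_forms_with_line_eq_mul :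
    Nat.card {p : MvPolynomial (Fin 4) K × Submodule K (Fin 4 → K) //
        (p.1.IsHomogeneous 3 ∧ SmoothCubic K p.1) ∧
        Module.finrank K p.2 = 2 ∧ ∀ v ∈ p.2, eval v p.1 = 0} =
      Nat.card {ℓ : Submodule K (Fin 4 → K) // Module.finrank K ℓ = 2} *
        Nat.card {F : MvPolynomial (Fin 4) K // (F.IsHomogeneous 3 ∧ SmoothCubic K F) ∧
          ∀ z w, eval ![0, 0, z, w] F = 0} := by
  rw [← Nat.card_prod]
  let e₁ : {p : MvPolynomial (Fin 4) K × Submodule K (Fin 4 → K) //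
        (p.1.IsHomogeneous 3 ∧ SmoothCubic K p.1) ∧
        Module.finrank K p.2 = 2 ∧ ∀ v ∈ p.2, eval v p.1 = 0} ≃
      Σ ℓ : {ℓ : Submodule K (Fin 4 → K) // Module.finrank K ℓ = 2},
        {F : MvPolynomial (Fin 4) K // (F.IsHomogeneous 3 ∧ SmoothCubic K F) ∧
          ∀ v ∈ ℓ.1, eval v F = 0} :=
    { toFun := fun p ↦ ⟨⟨p.1.2, p.2.2.1⟩, ⟨p.1.1, p.2.1, p.2.2.2⟩⟩
      invFun := fun x ↦ ⟨(x.2.1, x.1.1), x.2.2.1, x.1.2, x.2.2.2⟩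
      left_inv := fun _ ↦ rfl
      right_inv := fun _ ↦ rfl }
  exact Nat.card_congr (e₁.trans ((Equiv.sigmaCongrRight fun ℓ ↦
    (nonempty_equiv_forms_vanishing_on ℓ.2).some).trans (Equiv.sigmaEquivProd _ _)))

variable [Fintype K]

theorem card_submodule_finrank_eq_mul (V : Type*) [AddCommGroup V] [Module K V] [Finite V]
    {k : ℕ} (hk : k ≤ Module.finrank K V) :
    Nat.card {ℓ : Submodule K V // Module.finrank K ℓ = k} *
        ∏ i : Fin k, (Fintype.card K ^ k - Fintype.card K ^ i.val) =
      ∏ i : Fin k, (Fintype.card K ^ Module.finrank K V - Fintype.card K ^ i.val) := by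
  classical
  have : Fintype {ℓ : Submodule K V // Module.finrank K ℓ = k} := Fintype.ofFinite _
  rw [← card_linearIndependent (K := K) (V := V) hk]
  let f : (Σ ℓ : {ℓ : Submodule K V // Module.finrank K ℓ = k},
      {s : Fin k → ℓ.1 // LinearIndependent K s}) → {s : Fin k → V // LinearIndependent K s} :=
    fun x ↦ ⟨fun i ↦ x.2.1 i, x.2.2.map' x.1.1.subtype x.1.1.ker_subtype⟩
  have hspan : ∀ x, Submodule.span K (Set.range (f x).1) = x.1.1 := by
    rintro ⟨⟨ℓ, hℓ⟩, ⟨s, hs⟩⟩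
    refine Submodule.eq_of_le_of_finrank_eq ?_ ?_
    · rw [Submodule.span_le]
      rintro _ ⟨i, rfl⟩
      exact (s i).2
    · rw [finrank_span_eq_card (f ⟨⟨ℓ, hℓ⟩, ⟨s, hs⟩⟩).2, Fintype.card_fin, hℓ]
  have hf : Function.Bijective f := by
    constructor
    · intro x y h
      have hxy : x.1 = y.1 := Subtype.ext ((hspan x).symm.trans (h ▸ hspan y))
      have hval : ∀ i, (x.2.1 i : V) = y.2.1 i := fun i ↦ congrFun (congrArg Subtype.val h) i
      clear h
      obtain ⟨ℓ, s⟩ := x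
      obtain ⟨ℓ', s'⟩ := y
      obtain rfl : ℓ = ℓ' := hxy
      obtain rfl : s = s' := Subtype.ext (funext fun i ↦ Subtype.ext (hval i))
      rfl
    · rintro ⟨s, hs⟩
      refine ⟨⟨⟨Submodule.span K (Set.range s), by
        rw [finrank_span_eq_card hs, Fintype.card_fin]⟩, ⟨_, linearIndependent_span hs⟩⟩, ?_⟩
      rfl
  rw [← Nat.card_congr (Equiv.ofBijective f hf), Nat.card_sigma,
    Finset.sum_congr rfl fun ℓ _ ↦ card_linearIndependent (K := K) (V := ℓ.1) ℓ.2.ge,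
    Finset.sum_congr rfl fun ℓ _ ↦ by rw [ℓ.2]]
  simp [Nat.card_eq_fintype_card]

theorem card_smooth_cubic_forms_with_line (h2 : (2 : K) ≠ 0) (h3 : (3 : K) ≠ 0) :
    Nat.card {p : MvPolynomial (Fin 4) K × Submodule K (Fin 4 → K) //
        (p.1.IsHomogeneous 3 ∧ SmoothCubic K p.1) ∧
        Module.finrank K p.2 = 2 ∧ ∀ v ∈ p.2, eval v p.1 = 0} =
      (Fintype.card K) ^ 4 *
        (((Fintype.card K) ^ 4 - 1) * ((Fintype.card K) ^ 4 - (Fintype.card K)) *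
          ((Fintype.card K) ^ 4 - (Fintype.card K) ^ 2) *
          ((Fintype.card K) ^ 4 - (Fintype.card K) ^ 3)) := by
  rw [card_smooth_cubic_forms_with_line_eq_mul, card_smooth_cubic_forms_vanishing_on_line h2 h3]
  have hL := card_submodule_finrank_eq_mul (K := K) (Fin 4 → K) (k := 2) (by simp)
  simp only [Module.finrank_fintype_fun_eq_card, Fintype.card_fin, Fin.prod_univ_two,
    Fin.val_zero, Fin.val_one, pow_zero, pow_one] at hL
  set q := Fintype.card K with hq
  have hsq : (squarefreePolys K 5).card = q ^ 3 * (q - 1) * (q ^ 2 - 1) := by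
    have h := card_squarefreePolys_five (K := K)
    have h1 : 1 ≤ q := Fintype.card_pos
    zify [h1, Nat.one_le_pow 2 q h1]
    exact h
  rw [hsq]
  calc _ = (Nat.card {ℓ : Submodule K (Fin 4 → K) // Module.finrank K ℓ = 2} *
      ((q ^ 2 - 1) * (q ^ 2 - q))) * (q ^ 2 * (q ^ 4 * (q ^ 3 * (q - 1) * (q ^ 2 - 1)))) := by ring
    _ = _ := by
      have e2 : q ^ 4 - q ^ 2 = q ^ 2 * (q ^ 2 - 1) := by rw [Nat.mul_sub]; ring_nf
      have e3 : q ^ 4 - q ^ 3 = q ^ 3 * (q - 1) := by rw [Nat.mul_sub]; ring_nf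
      rw [hL, e2, e3]
      ring

end CountLines

/-- Away from finitely many characteristics, the number of pairs `(F, ℓ)` of a smooth
homogeneous cubic form over `𝔽_q` and a 2-dimensional subspace `ℓ ⊆ 𝔽_q⁴` on which `F`
vanishes identically equals `q⁴(q⁴-1)(q⁴-q)(q⁴-q²)(q⁴-q³)`. -/
theorem count_smooth_cubic_forms_with_line :
    ∃ S : Finset ℕ, (∀ p ∈ S, p.Prime) ∧
      ∀ (K : Type) (_ : Field K) (_ : Fintype K), ringChar K ∉ S →
        Nat.card {p : MvPolynomial (Fin 4) K × Submodule K (Fin 4 → K) //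
            (p.1.IsHomogeneous 3 ∧ SmoothCubic K p.1) ∧
            Module.finrank K p.2 = 2 ∧ ∀ v ∈ p.2, eval v p.1 = 0} =
          (Fintype.card K) ^ 4 *
            (((Fintype.card K) ^ 4 - 1) * ((Fintype.card K) ^ 4 - (Fintype.card K)) *
              ((Fintype.card K) ^ 4 - (Fintype.card K) ^ 2) *
              ((Fintype.card K) ^ 4 - (Fintype.card K) ^ 3)) := by
  refine ⟨{2, 3}, by decide, fun K _ _ hS ↦ ?_⟩
  have hp : ∀ p : ℕ, p.Prime → ringChar K ≠ p → (p : K) ≠ 0 := fun p hp hne h ↦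
    (hp.eq_one_or_self_of_dvd _ ((ringChar.spec K p).1 h)).elim CharP.ringChar_ne_one hne
  simp only [Finset.mem_insert, Finset.mem_singleton, not_or] at hS
  exact card_smooth_cubic_forms_with_line (by exact_mod_cast hp 2 Nat.prime_two hS.1)
    (by exact_mod_cast hp 3 Nat.prime_three hS.2)
end

section
/- Let ℓ ⊆ ℂ⁴ be a 2-dimensional ℂ-linear subspace and let P ∈ ℓ be a nonzero vector. Then the set of homogeneous cubic forms F over ℂ that vanish identically on ℓ and are singular at P is a ℂ-linear subspace of dimension 14 of the space of homogeneous cubic forms. -/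
open MvPolynomial

namespace MvPolynomial

section General

variable {σ τ R : Type*} [CommRing R]

lemma eval_bind₁ (g : σ → MvPolynomial τ R) (F : MvPolynomial σ R) (v : τ → R) :
    eval v (bind₁ g F) = eval (fun k ↦ eval v (g k)) F :=
  eval₂Hom_bind₁ (RingHom.id R) v g F

/-- The chain rule for substitution of polynomials, evaluated at a point. -/
lemma eval_pderiv_bind₁ [Fintype σ] (g : σ → MvPolynomial τ R) (F : MvPolynomial σ R)
    (v : τ → R) (j : τ) :
    eval v (pderiv j (bind₁ g F)) =
      ∑ i, eval v (pderiv j (g i)) * eval (fun k ↦ eval v (g k)) (pderiv i F) := by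
  classical
  induction F using MvPolynomial.induction_on with
  | C a => simp
  | add p q hp hq => simp [hp, hq, mul_add, Finset.sum_add_distrib]
  | mul_X p i hp =>
    simp only [map_mul, bind₁_X_right, Derivation.leibniz, smul_eq_mul, map_add, hp, eval_bind₁,
      pderiv_X, eval_X, mul_add, Finset.sum_add_distrib, Finset.mul_sum]
    congr 1
    · rw [Finset.sum_eq_single i (fun k _ hk ↦ ?_) (by simp)]
      · simp [mul_comm]
      · simp [Pi.single_eq_of_ne' hk]
    · exact Finset.sum_congr rfl fun _ _ ↦ by ring

/-- A homogeneous polynomial takes at a standard basis vector the value of the coefficient of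
the corresponding pure power. -/
lemma IsHomogeneous.eval_single [DecidableEq σ] [Fintype σ] {p : MvPolynomial σ R} {n : ℕ}
    (hp : p.IsHomogeneous n) (i : σ) :
    eval (Pi.single i 1) p = coeff (Finsupp.single i n) p := by
  rw [eval_eq', Finset.sum_eq_single (Finsupp.single i n)]
  · rw [Finset.prod_eq_one, mul_one]
    intro k _
    rcases eq_or_ne k i with rfl | hk
    · simp
    · simp [Finsupp.single_eq_of_ne hk]
  · intro d hd hne
    have hdeg : d.degree = n := by
      rw [Finsupp.degree_eq_weight_one]
      exact hp (mem_support_iff.mp hd)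
    obtain ⟨k, hki, hk⟩ : ∃ k, k ≠ i ∧ d k ≠ 0 := by
      by_contra! h
      have hd' : d = Finsupp.single i (d i) := by
        ext k
        rcases eq_or_ne k i with rfl | hk
        · simp
        · simp [Finsupp.single_eq_of_ne hk, h k hk]
      rw [hd', Finsupp.degree_single] at hdeg
      exact hne (hdeg ▸ hd')
    rw [Finset.prod_eq_zero (Finset.mem_univ k), mul_zero]
    simp [Pi.single_eq_of_ne hki, hk]
  · intro h
    simp [notMem_support_iff.mp h]

/-- Setting the variables outside `s` to zero keeps exactly the monomials in the variables
in `s`. -/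
lemma coeff_bind₁_ite (s : σ → Prop) [DecidablePred s] (p : MvPolynomial σ R) (d : σ →₀ ℕ)
    (hd : ∀ i, ¬ s i → d i = 0) :
    coeff d (bind₁ (fun i ↦ if s i then X i else 0) p) = coeff d p := by
  classical
  induction p using MvPolynomial.induction_on' with
  | add p q hp hq => simp [hp, hq]
  | monomial e a =>
    by_cases he : ∀ i, ¬ s i → e i = 0
    · rw [bind₁_monomial, monomial_eq (s := e), Finset.prod_congr rfl (g := fun i ↦ X i ^ e i)]
      · rfl
      · intro i hi
        rw [if_pos]
        by_contra h
        exact (Finsupp.mem_support_iff.mp hi) (he i h)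
    · push Not at he
      obtain ⟨i, hi, hei⟩ := he
      rw [bind₁_monomial, Finset.prod_eq_zero (Finsupp.mem_support_iff.mpr hei) (by simp [hi, hei]),
        mul_zero, coeff_zero, coeff_monomial, if_neg]
      rintro rfl
      exact hei (hd i hi)

/-- A polynomial over an infinite domain which vanishes wherever the variables outside `s` vanish
has no monomials in the variables in `s` only. -/
lemma coeff_eq_zero_of_eval_eq_zero [IsDomain R] [Infinite R] (s : σ → Prop)
    {p : MvPolynomial σ R} (hp : ∀ w : σ → R, (∀ i, ¬ s i → w i = 0) → eval w p = 0)
    (d : σ →₀ ℕ) (hd : ∀ i, ¬ s i → d i = 0) : coeff d p = 0 := by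
  classical
  rw [← coeff_bind₁_ite s p d hd]
  suffices h : bind₁ (fun i ↦ if s i then X i else 0) p = 0 by rw [h, coeff_zero]
  refine MvPolynomial.funext fun x ↦ ?_
  rw [map_zero, ← hp (fun i ↦ if s i then x i else 0) (fun i hi ↦ if_neg hi)]
  simp only [eval_bind₁, apply_ite, eval_X, map_zero]

lemma finrank_restrictSupport [Nontrivial R] (s : Set (σ →₀ ℕ)) :
    Module.finrank R (restrictSupport R s) = s.ncard :=
  Module.finrank_eq_nat_card_basis (basisRestrictSupport R s)

/-- The linear substitution of variables given by an invertible matrix. -/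
noncomputable def linearSubstEquiv {n : Type*} [Fintype n] [DecidableEq n] (A B : Matrix n n R)
    (hAB : A * B = 1) (hBA : B * A = 1) : MvPolynomial n R ≃ₐ[R] MvPolynomial n R :=
  AlgEquiv.ofAlgHom (bind₁ A.toMvPolynomial) (bind₁ B.toMvPolynomial)
    (by ext1 i; simp [← Matrix.toMvPolynomial_mul, hBA, Matrix.toMvPolynomial_one])
    (by ext1 i; simp [← Matrix.toMvPolynomial_mul, hAB, Matrix.toMvPolynomial_one])

end General

/-- `F` is a form of degree `d` vanishing on `ℓ` and singular at `P`. -/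
def IsSingularFormOn {σ R : Type*} [CommRing R] (d : ℕ) (ℓ : Set (σ → R)) (P : σ → R)
    (F : MvPolynomial σ R) : Prop :=
  F.IsHomogeneous d ∧ (∀ v ∈ ℓ, eval v F = 0) ∧ ∀ i, eval P (pderiv i F) = 0

lemma IsSingularFormOn.linearSubst {n R : Type*} [CommRing R] [Fintype n]
    {d : ℕ} {ℓ ℓ' : Set (n → R)} {P P' : n → R} {F : MvPolynomial n R}
    (hF : IsSingularFormOn d ℓ P F) (A : Matrix n n R) (hℓ : ∀ v ∈ ℓ', A.mulVec v ∈ ℓ)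
    (hP : A.mulVec P' = P) :
    IsSingularFormOn d ℓ' P' (bind₁ A.toMvPolynomial F) := by
  obtain ⟨h1, h2, h3⟩ := hF
  refine ⟨?_, fun v hv ↦ ?_, fun i ↦ ?_⟩
  · simpa using h1.aeval A.toMvPolynomial (n := 1) A.toMvPolynomial_isHomogeneous
  · rw [← h2 _ (hℓ v hv)]
    simp only [eval_bind₁, Matrix.toMvPolynomial_eval_eq_apply]
  · simp only [eval_pderiv_bind₁, Matrix.toMvPolynomial_eval_eq_apply]
    refine Finset.sum_eq_zero fun k _ ↦ ?_
    have : (fun k ↦ A.mulVec P' k) = P := hP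
    rw [this, h3, mul_zero]

/-- The exponents of degree `3` which involve one of the last two variables and are at most linear
in the first one. -/
def singularCubicExponents : Set (Fin 4 →₀ ℕ) :=
  {d | d.degree = 3 ∧ d 0 ≤ 1 ∧ (d 2 ≠ 0 ∨ d 3 ≠ 0)}

lemma ncard_setOf_degree_and (n k : ℕ) (q : (Fin k → ℕ) → Prop) [DecidablePred q] :
    {d : Fin k →₀ ℕ | d.degree = n ∧ q d}.ncard =
      ((Finset.Nat.antidiagonalTuple k n).filter q).card := by
  rw [← Set.ncard_coe_finset, ← Set.ncard_image_of_injective _ Finsupp.equivFunOnFinite.injective]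
  congr 1
  ext x
  simp only [Set.mem_image, Set.mem_ofPred_eq, Finset.coe_filter, Finset.Nat.mem_antidiagonalTuple]
  constructor
  · rintro ⟨d, ⟨h, hq⟩, rfl⟩
    exact ⟨by simpa [Finsupp.degree_eq_sum] using h, hq⟩
  · rintro ⟨h, hq⟩
    exact ⟨Finsupp.equivFunOnFinite.symm x, ⟨by simpa [Finsupp.degree_eq_sum] using h, hq⟩,
      by simp⟩

lemma ncard_singularCubicExponents : singularCubicExponents.ncard = 14 :=
  (ncard_setOf_degree_and 3 4 fun d ↦ d 0 ≤ 1 ∧ (d 2 ≠ 0 ∨ d 3 ≠ 0)).trans (by decide)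

lemma finrank_homogeneousSubmodule_four_three {R : Type*} [CommRing R] [Nontrivial R] :
    Module.finrank R (homogeneousSubmodule (Fin 4) R 3) = 20 := by
  rw [homogeneousSubmodule_eq_finsupp_supported]
  refine (finrank_restrictSupport _).trans ?_
  have h := ncard_setOf_degree_and 3 4 fun _ ↦ True
  simp only [and_true] at h
  exact h.trans (by decide)

/-- The cubic forms vanishing on the plane spanned by the first two standard basis vectors and
singular at the first one are characterised by their monomials. -/
lemma mem_restrictSupport_singularCubicExponents {R : Type*} [CommRing R] [IsDomain R] [CharZero R]
    {F : MvPolynomial (Fin 4) R} :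
    F ∈ restrictSupport R singularCubicExponents ↔
      IsSingularFormOn 3 {w | ∀ i, ¬ i < 2 → w i = 0} (Pi.single 0 1) F := by
  rw [mem_restrictSupport_iff]
  constructor
  · intro h
    have hhom : F.IsHomogeneous 3 := fun d hd ↦ by
      have h1 := (h (mem_support_iff.mpr hd)).1
      rwa [Finsupp.degree_eq_weight_one] at h1
    refine ⟨hhom, fun v hv ↦ ?_, fun i ↦ ?_⟩
    · rw [eval_eq']
      refine Finset.sum_eq_zero fun d hd ↦ ?_
      rcases (h hd).2.2 with h2 | h2
      · rw [Finset.prod_eq_zero (Finset.mem_univ 2), mul_zero]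
        rw [hv 2 (by decide), zero_pow h2]
      · rw [Finset.prod_eq_zero (Finset.mem_univ 3), mul_zero]
        rw [hv 3 (by decide), zero_pow h2]
    · rw [IsHomogeneous.eval_single (n := 2) hhom.pderiv, coeff_pderiv, notMem_support_iff.mp,
        zero_mul]
      intro hmem
      have := (h hmem).2.1
      rw [Finsupp.add_apply, Finsupp.single_eq_same] at this
      omega
  · rintro ⟨hhom, hv, hs⟩ d hd
    have hdeg : d.degree = 3 := by
      rw [Finsupp.degree_eq_weight_one]
      exact hhom (mem_support_iff.mp hd)
    rw [SetLike.mem_coe, mem_support_iff] at hd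
    refine ⟨hdeg, ?_, ?_⟩
    · by_contra! h0
      obtain ⟨e, rfl⟩ := le_iff_exists_add.mp (Finsupp.single_le_iff.mpr (Nat.succ_le_of_lt h0))
      rw [map_add, Finsupp.degree_single] at hdeg
      obtain ⟨i, rfl⟩ : e ∈ Set.range fun i : Fin 4 ↦ Finsupp.single i 1 := by
        rw [Finsupp.range_single_one]
        change e.degree = 1
        omega
      have := hs i
      rw [IsHomogeneous.eval_single (n := 2) hhom.pderiv, coeff_pderiv] at this
      refine hd ((mul_eq_zero.mp this).resolve_right (Nat.cast_add_one_ne_zero _))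
    · by_contra! h0
      refine hd (coeff_eq_zero_of_eval_eq_zero (· < 2) hv d fun i hi ↦ ?_)
      fin_cases i
      · simp at hi
      · simp at hi
      · exact h0.1
      · exact h0.2

end MvPolynomial

/-- A nonzero vector of a 2-dimensional subspace of a 4-dimensional coordinate space is the first
vector of a basis whose first two vectors lie in the subspace. -/
lemma exists_basis_of_mem_of_finrank_eq_two {K : Type*} [Field K] {ℓ : Submodule K (Fin 4 → K)}
    (hℓ : Module.finrank K ℓ = 2) {P : Fin 4 → K} (hP : P ∈ ℓ) (hP0 : P ≠ 0) :
    ∃ b : Module.Basis (Fin 4) K (Fin 4 → K), b 0 = P ∧ ℓ = Submodule.span K {b 0, b 1} := by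
  have h1 : LinearIndependent K ![(⟨P, hP⟩ : ℓ)] :=
    LinearIndependent.of_subsingleton 0 (by simpa using hP0)
  obtain ⟨Q, h2⟩ := exists_linearIndependent_snoc_of_lt_finrank h1 (by omega)
  have hspan := congrArg (Submodule.map ℓ.subtype)
    (h2.span_eq_top_of_card_eq_finrank (by simp [hℓ]))
  rw [Submodule.map_span, ← Set.range_comp, Submodule.map_subtype_top] at hspan
  have h2' := h2.map' ℓ.subtype ℓ.ker_subtype
  obtain ⟨S, h3⟩ := exists_linearIndependent_snoc_of_lt_finrank h2' (by simp)
  obtain ⟨T, h4⟩ := exists_linearIndependent_snoc_of_lt_finrank h3 (by simp)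
  refine ⟨basisOfLinearIndependentOfCardEqFinrank h4 (by simp), ?_, ?_⟩
  · rw [coe_basisOfLinearIndependentOfCardEqFinrank]
    rfl
  · rw [coe_basisOfLinearIndependentOfCardEqFinrank]
    refine hspan.symm.trans ?_
    congr 1
    ext x
    simp only [Set.mem_range, Set.mem_insert_iff, Set.mem_singleton_iff,
      eq_comm (a := x)]
    exact Fin.exists_fin_two

/-- For a 2-dimensional subspace `ℓ ⊆ ℂ⁴` and a nonzero point `P ∈ ℓ`, the homogeneous
cubic forms vanishing identically on `ℓ` and singular at `P` form a 14-dimensional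
linear subspace of the 20-dimensional space of homogeneous cubic forms. -/
theorem forms_vanishing_on_line_singular_at_point_on_line (ℓ : Submodule ℂ (Fin 4 → ℂ))
    (hℓ : Module.finrank ℂ ℓ = 2) (P : Fin 4 → ℂ) (hP : P ∈ ℓ) (hP0 : P ≠ 0) :
    ∃ L : Submodule ℂ (MvPolynomial (Fin 4) ℂ),
      (L : Set (MvPolynomial (Fin 4) ℂ)) =
        {F | F.IsHomogeneous 3 ∧ (∀ v ∈ ℓ, eval v F = 0) ∧
          ∀ i : Fin 4, eval P (pderiv i F) = 0} ∧
      Module.finrank ℂ L = 14 ∧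
      Module.finrank ℂ (homogeneousSubmodule (Fin 4) ℂ 3) = 20 := by
  obtain ⟨b, hb0, hb⟩ := exists_basis_of_mem_of_finrank_eq_two hℓ hP hP0
  let A := (Pi.basisFun ℂ (Fin 4)).toMatrix b
  let B := b.toMatrix (Pi.basisFun ℂ (Fin 4))
  have hAB : A * B = 1 := Module.Basis.toMatrix_mul_toMatrix_flip _ _
  have hBA : B * A = 1 := Module.Basis.toMatrix_mul_toMatrix_flip _ _
  have hA0 : A.mulVec (Pi.single 0 1) = P := by
    ext i
    simp [A, Module.Basis.toMatrix_apply, hb0]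
  have hB0 : B.mulVec P = Pi.single 0 1 := by
    rw [← hA0, Matrix.mulVec_mulVec, hBA, Matrix.one_mulVec]
  have hA1 : A.mulVec (Pi.single 1 1) = b 1 := by
    ext i
    simp [A, Module.Basis.toMatrix_apply]
  have hB1 : B.mulVec (b 1) = Pi.single 1 1 := by
    rw [← hA1, Matrix.mulVec_mulVec, hBA, Matrix.one_mulVec]
  have hAℓ : ∀ w ∈ {w : Fin 4 → ℂ | ∀ i, ¬ i < 2 → w i = 0}, A.mulVec w ∈ (ℓ : Set _) := by
    intro w hw
    have : A.mulVec w = w 0 • b 0 + w 1 • b 1 := by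
      ext i
      simp [A, Matrix.mulVec, dotProduct, Fin.sum_univ_four, Module.Basis.toMatrix_apply,
        hw 2 (by decide), hw 3 (by decide), mul_comm]
    rw [this]
    exact hb ▸ Submodule.mem_span_pair.mpr ⟨_, _, rfl⟩
  have hBℓ : ∀ v ∈ (ℓ : Set _), B.mulVec v ∈ {w : Fin 4 → ℂ | ∀ i, ¬ i < 2 → w i = 0} := by
    intro v hv i hi
    obtain ⟨s, t, rfl⟩ := Submodule.mem_span_pair.mp (hb ▸ hv)
    rw [Matrix.mulVec_add, Matrix.mulVec_smul, Matrix.mulVec_smul, hb0, hB0, hB1]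
    have h0 : i ≠ 0 := by rintro rfl; exact hi (by decide)
    have h1 : i ≠ 1 := by rintro rfl; exact hi (by decide)
    simp [h0, h1]
  let e := (linearSubstEquiv A B hAB hBA).toLinearEquiv
  refine ⟨(restrictSupport ℂ singularCubicExponents).map e.symm.toLinearMap, ?_, ?_,
    finrank_homogeneousSubmodule_four_three⟩
  · ext F
    refine (Submodule.mem_map_equiv (e := e.symm) _).trans ?_
    rw [mem_restrictSupport_singularCubicExponents]
    change IsSingularFormOn _ _ _ (bind₁ A.toMvPolynomial F) ↔ IsSingularFormOn 3 (ℓ : Set _) P F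
    refine ⟨fun h ↦ ?_, fun h ↦ h.linearSubst A hAℓ hA0⟩
    have := h.linearSubst B hBℓ hB0
    rwa [show bind₁ B.toMvPolynomial (bind₁ A.toMvPolynomial F) = F from
      e.symm_apply_apply F] at this
  · rw [LinearEquiv.finrank_map_eq, finrank_restrictSupport, ncard_singularCubicExponents]
end

section
/- Let ℓ ⊆ ℂ⁴ be a 2-dimensional ℂ-linear subspace and let P ∈ ℂ⁴ be a nonzero vector with P ∉ ℓ. Then the set of homogeneous cubic forms F over ℂ that vanish identically on ℓ and are singular at P is a ℂ-linear subspace of dimension 12 of the space of homogeneous cubic forms. -/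
open MvPolynomial

/-- The dimension of the space of forms of degree `d` in the variables `σ`. -/
theorem finrank_homogeneousSubmodule {σ K : Type*} [Fintype σ] [Field K] (d : ℕ) :
    Module.finrank K (homogeneousSubmodule σ K d) = (Fintype.card σ).multichoose d := by
  classical
  have hs : homogeneousSubmodule σ K d
      = restrictSupport K {m : σ →₀ ℕ | m.degree = d} :=
    homogeneousSubmodule_eq_finsupp_supported σ K d
  rw [hs, Module.finrank_eq_nat_card_basis (basisRestrictSupport K _),
    ← Sym.card_sym_eq_multichoose σ d, ← Nat.card_eq_fintype_card]
  refine Nat.card_congr ((Sym.equivNatSum σ d).trans (Equiv.subtypeEquivRight fun m => ?_)).symm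
  simp [Finsupp.degree_apply, Finsupp.sum]

section RestrictLine

variable {σ K : Type*} [Field K]

/-- Restriction of a polynomial to the affine line `t ↦ a + t b`. -/
noncomputable def restrictLine (a b : σ → K) : MvPolynomial σ K →ₐ[K] Polynomial K :=
  aeval fun i => Polynomial.C (a i) + Polynomial.C (b i) * Polynomial.X

theorem eval_restrictLine (a b : σ → K) (F : MvPolynomial σ K) (t : K) :
    (restrictLine a b F).eval t = eval (a + t • b) F := by
  have h : ((Polynomial.aeval t).comp (restrictLine a b)) = aeval (a + t • b) := by
    ext i
    simp [restrictLine, mul_comm t]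
  simpa [Polynomial.aeval_def, Polynomial.eval₂_id, aeval_eq_eval] using congr($h F)

theorem eval_smul_of_isHomogeneous {F : MvPolynomial σ K} {d : ℕ} (hF : F.IsHomogeneous d)
    (r : K) (v : σ → K) : eval (r • v) F = r ^ d * eval v F := by
  rw [eval_eq, eval_eq, Finset.mul_sum]
  refine Finset.sum_congr rfl fun m hm => ?_
  have hd : ∑ i ∈ m.support, m i = d := by
    rw [← Finsupp.degree_apply, Finsupp.degree_eq_weight_one]
    exact hF (mem_support_iff.1 hm)
  simp only [Pi.smul_apply, smul_eq_mul, mul_pow, Finset.prod_mul_distrib,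
    Finset.prod_pow_eq_pow_sum, hd]
  ring

theorem natDegree_restrictLine_le (a b : σ → K) {F : MvPolynomial σ K} {d : ℕ}
    (hF : F.IsHomogeneous d) : (restrictLine a b F).natDegree ≤ d := by
  have := aeval_natDegree_le (n := 1) F hF.totalDegree_le
    (fun i => Polynomial.C (a i) + Polynomial.C (b i) * Polynomial.X)
    (fun i => by rw [add_comm]; exact Polynomial.natDegree_linear_le)
  simpa [restrictLine] using this

/-- A form vanishes on the span of `a` and `b` iff it vanishes on the affine line `a + t b`. -/
theorem restrictLine_eq_zero_iff [Infinite K] (a b : σ → K) {F : MvPolynomial σ K} {d : ℕ}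
    (hF : F.IsHomogeneous d) :
    restrictLine a b F = 0 ↔ ∀ s t : K, eval (s • a + t • b) F = 0 := by
  constructor
  · intro h s t
    have hne : ∀ r : K, r ≠ 0 → eval (r • a + t • b) F = 0 := by
      intro r hr
      have e : r • a + t • b = r • (a + (t / r) • b) := by
        rw [smul_add, smul_smul, mul_div_cancel₀ _ hr]
      have h0 := eval_restrictLine a b F (t / r)
      rw [h, Polynomial.eval_zero] at h0
      rw [e, eval_smul_of_isHomogeneous hF, ← h0, mul_zero]
    have hq : Polynomial.X * restrictLine (t • b) a F = 0 := by
      refine Polynomial.funext fun r => ?_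
      by_cases hr : r = 0
      · simp [hr]
      · simp [eval_restrictLine, add_comm (t • b), hne r hr]
    have hq' := (mul_eq_zero.1 hq).resolve_left Polynomial.X_ne_zero
    rw [add_comm, ← eval_restrictLine, hq', Polynomial.eval_zero]
  · intro h
    refine Polynomial.funext fun t => ?_
    simpa [eval_restrictLine] using h 1 t

end RestrictLine

/-- The linear form with the same values as the linear functional `g`. -/
noncomputable def linearForm {σ K : Type*} [Fintype σ] [DecidableEq σ] [Field K]
    (g : (σ → K) →ₗ[K] K) : MvPolynomial σ K :=
  ∑ i, C (g (Pi.single i 1)) * X i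

section LinearForm

variable {σ K : Type*} [Fintype σ] [DecidableEq σ] [Field K]

theorem sum_apply_single_mul (g : (σ → K) →ₗ[K] K) (v : σ → K) :
    ∑ i, g (Pi.single i 1) * v i = g v := by
  conv_rhs => rw [LinearMap.pi_apply_eq_sum_univ g v]
  refine Finset.sum_congr rfl fun i _ => ?_
  rw [smul_eq_mul, mul_comm]
  congr 2
  ext j
  simp [Pi.single_apply, eq_comm]

theorem linearForm_isHomogeneous (g : (σ → K) →ₗ[K] K) : (linearForm g).IsHomogeneous 1 :=
  IsHomogeneous.sum _ _ _ fun i _ => by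
    simpa using (isHomogeneous_C σ (g (Pi.single i 1))).mul (isHomogeneous_X K i)

theorem eval_linearForm (g : (σ → K) →ₗ[K] K) (v : σ → K) : eval v (linearForm g) = g v := by
  simp [linearForm, sum_apply_single_mul]

theorem pderiv_linearForm (g : (σ → K) →ₗ[K] K) (i : σ) :
    pderiv i (linearForm g) = C (g (Pi.single i 1)) := by
  simp [linearForm, pderiv_X, Pi.single_apply]

theorem restrictLine_linearForm (a b : σ → K) (g : (σ → K) →ₗ[K] K) :
    restrictLine a b (linearForm g)
      = Polynomial.C (g a) + Polynomial.C (g b) * Polynomial.X := by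
  rw [← sum_apply_single_mul g a, ← sum_apply_single_mul g b]
  simp only [restrictLine, linearForm, map_sum, map_mul, aeval_X, algHom_C, Finset.sum_mul,
    ← Finset.sum_add_distrib, Polynomial.algebraMap_eq]
  exact Finset.sum_congr rfl fun i _ => by ring

end LinearForm

/-- The coefficients up to degree three of the restriction to a line, and the gradient at `P`. -/
noncomputable def lineAndGradient (a b P : Fin 4 → ℂ) :
    MvPolynomial (Fin 4) ℂ →ₗ[ℂ] (Fin 4 → ℂ) × (Fin 4 → ℂ) :=
  (LinearMap.pi fun k : Fin 4 =>
      Polynomial.lcoeff ℂ (k : ℕ) ∘ₗ (restrictLine a b).toLinearMap).prod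
    (LinearMap.pi fun i => (aeval P).toLinearMap ∘ₗ (pderiv i).toLinearMap)

theorem lineAndGradient_eq_zero_iff (a b P : Fin 4 → ℂ) {F : MvPolynomial (Fin 4) ℂ}
    (hF : F.IsHomogeneous 3) :
    lineAndGradient a b P F = 0 ↔
      (∀ s t : ℂ, eval (s • a + t • b) F = 0) ∧ ∀ i, eval P (pderiv i F) = 0 := by
  rw [← restrictLine_eq_zero_iff a b hF, Prod.ext_iff]
  refine and_congr ⟨fun h => ?_, fun h => ?_⟩ ?_
  · ext n
    by_cases hn : n < 4
    · simpa [lineAndGradient] using congrFun h ⟨n, hn⟩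
    · exact Polynomial.coeff_eq_zero_of_natDegree_lt
        ((natDegree_restrictLine_le a b hF).trans_lt (by lia))
  · ext k
    simp [lineAndGradient, h]
  · simp [lineAndGradient, funext_iff, aeval_eq_eval]

theorem lineAndGradient_domRestrict_surjective {a b P : Fin 4 → ℂ} {x y z : (Fin 4 → ℂ) →ₗ[ℂ] ℂ}
    (hxa : x a = 1) (hxb : x b = 0) (hxP : x P = 0)
    (hya : y a = 0) (hyb : y b = 1) (hyP : y P = 0)
    (hza : z a = 0) (hzb : z b = 0) (hzP : z P = 1) :
    Function.Surjective
      ((lineAndGradient a b P).domRestrict (homogeneousSubmodule (Fin 4) ℂ 3)) := by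
  rintro ⟨u, w⟩
  have hx := linearForm_isHomogeneous x
  have hy := linearForm_isHomogeneous y
  have hz := linearForm_isHomogeneous z
  let g : (Fin 4 → ℂ) →ₗ[ℂ] ℂ := ∑ i, w i • LinearMap.proj i
  have hg : ∀ i, g (Pi.single i 1) = w i := fun i => by
    simp [g, Pi.single_apply]
  let m : (Fin 4 → ℂ) →ₗ[ℂ] ℂ := g - (2 / 3 * g P) • z
  have hcube : ∀ {p q r : MvPolynomial (Fin 4) ℂ}, p.IsHomogeneous 1 → q.IsHomogeneous 1 →
      r.IsHomogeneous 1 → ∀ c : ℂ, (C c * (p * q * r)).IsHomogeneous 3 :=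
    fun hp hq hr c => ((hp.mul hq).mul hr).C_mul c
  let F := C (u 0) * (linearForm x * linearForm x * linearForm x)
    + C (u 1) * (linearForm x * linearForm x * linearForm y)
    + C (u 2) * (linearForm x * linearForm y * linearForm y)
    + C (u 3) * (linearForm y * linearForm y * linearForm y)
    + C 1 * (linearForm z * linearForm z * linearForm m)
  have hF : F.IsHomogeneous 3 :=
    ((((hcube hx hx hx _).add (hcube hx hx hy _)).add (hcube hx hy hy _)).add
      (hcube hy hy hy _)).add (hcube hz hz (linearForm_isHomogeneous m) _)
  refine ⟨⟨F, hF⟩, ?_⟩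
  have hline : restrictLine a b F = Polynomial.C (u 0) + Polynomial.C (u 1) * Polynomial.X
      + Polynomial.C (u 2) * Polynomial.X ^ 2 + Polynomial.C (u 3) * Polynomial.X ^ 3 := by
    simp only [F, map_add, map_mul, restrictLine_linearForm, hxa, hxb, hya, hyb, hza, hzb,
      algHom_C, Polynomial.algebraMap_eq, map_zero, map_one]
    ring
  have hgrad : ∀ i, eval P (pderiv i F) = w i := fun i => by
    simp only [F, map_add, Derivation.leibniz, pderiv_linearForm, pderiv_C, smul_eq_mul, map_mul,
      eval_linearForm, eval_C, hxP, hyP, hzP, m, LinearMap.sub_apply, LinearMap.smul_apply, hg,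
      map_zero]
    ring
  refine Prod.ext (funext fun k => ?_) (funext fun i => ?_)
  · fin_cases k <;>
      simp [lineAndGradient, hline, Polynomial.coeff_X, Polynomial.coeff_C, Polynomial.coeff_X_pow]
  · simpa [lineAndGradient, aeval_eq_eval] using hgrad i

/-- For a 2-dimensional subspace `ℓ ⊆ ℂ⁴` and a nonzero point `P ∉ ℓ`, the homogeneous
cubic forms vanishing identically on `ℓ` and singular at `P` form a 12-dimensional
linear subspace of the 20-dimensional space of homogeneous cubic forms. -/
theorem forms_vanishing_on_line_singular_at_point_off_line (ℓ : Submodule ℂ (Fin 4 → ℂ))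
    (hℓ : Module.finrank ℂ ℓ = 2) (P : Fin 4 → ℂ) (hP : P ∉ ℓ) (hP0 : P ≠ 0) :
    ∃ L : Submodule ℂ (MvPolynomial (Fin 4) ℂ),
      (L : Set (MvPolynomial (Fin 4) ℂ)) =
        {F | F.IsHomogeneous 3 ∧ (∀ v ∈ ℓ, eval v F = 0) ∧
          ∀ i : Fin 4, eval P (pderiv i F) = 0} ∧
      Module.finrank ℂ L = 12 ∧
      Module.finrank ℂ (homogeneousSubmodule (Fin 4) ℂ 3) = 20 := by
  have h20 : Module.finrank ℂ (homogeneousSubmodule (Fin 4) ℂ 3) = 20 := by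
    rw [finrank_homogeneousSubmodule, Fintype.card_fin]
    simp [Nat.multichoose_eq, Nat.choose]
  let β := Module.finBasisOfFinrankEq ℂ ℓ hℓ
  let a : Fin 4 → ℂ := β 0
  let b : Fin 4 → ℂ := β 1
  have hspan : ∀ v, v ∈ ℓ ↔ ∃ s t : ℂ, v = s • a + t • b := fun v => by
    constructor
    · intro hv
      refine ⟨β.repr ⟨v, hv⟩ 0, β.repr ⟨v, hv⟩ 1, ?_⟩
      have := congrArg Subtype.val (β.sum_repr ⟨v, hv⟩)
      rw [Fin.sum_univ_two] at this
      exact this.symm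
    · rintro ⟨s, t, rfl⟩
      exact ℓ.add_mem (ℓ.smul_mem _ (β 0).2) (ℓ.smul_mem _ (β 1).2)
  obtain ⟨x, hx, hxP⟩ := LinearMap.exists_extend_of_notMem (β.coord 0) hP 0
  obtain ⟨y, hy, hyP⟩ := LinearMap.exists_extend_of_notMem (β.coord 1) hP 0
  obtain ⟨z, hz, hzP⟩ := LinearMap.exists_extend_of_notMem (0 : ℓ →ₗ[ℂ] ℂ) hP 1
  let T := (lineAndGradient a b P).domRestrict (homogeneousSubmodule (Fin 4) ℂ 3)
  have hT : Function.Surjective T := lineAndGradient_domRestrict_surjective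
    (by simpa using congr($hx (β 0))) (by simpa using congr($hx (β 1))) hxP
    (by simpa using congr($hy (β 0))) (by simpa using congr($hy (β 1))) hyP
    (by simpa using congr($hz (β 0))) (by simpa using congr($hz (β 1))) hzP
  refine ⟨(LinearMap.ker T).map (homogeneousSubmodule (Fin 4) ℂ 3).subtype, ?_, ?_, h20⟩
  · ext F
    have key (hF : F.IsHomogeneous 3) : lineAndGradient a b P F = 0 ↔
        (∀ v ∈ ℓ, eval v F = 0) ∧ ∀ i, eval P (pderiv i F) = 0 := by
      rw [lineAndGradient_eq_zero_iff a b P hF]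
      refine and_congr_left' ⟨fun h v hv => ?_, fun h s t => h _ ((hspan _).2 ⟨s, t, rfl⟩)⟩
      obtain ⟨s, t, rfl⟩ := (hspan v).1 hv
      exact h s t
    simp only [SetLike.mem_coe, Submodule.mem_map, Set.mem_ofPred_eq]
    constructor
    · rintro ⟨⟨F, hF⟩, hker, rfl⟩
      exact ⟨hF, (key hF).1 hker⟩
    · rintro ⟨hF, h⟩
      exact ⟨⟨F, hF⟩, (key hF).2 h, rfl⟩
  · have : Module.Finite ℂ (homogeneousSubmodule (Fin 4) ℂ 3) :=
      Module.finite_of_finrank_pos (by lia)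
    rw [Submodule.finrank_map_subtype_eq]
    have h := T.finrank_range_add_finrank_ker
    rw [LinearMap.range_eq_top.2 hT, finrank_top, h20] at h
    simp at h
    lia
end
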